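/- arXiv:2311.05148 — 2 statements merged into one kernel-verified Lean document; each statement's English description precedes it below -/
import Mathlib

section
/- For all constants c_1, c_2 > 0 there exists a constant c_3 > 0 such that the following holds. Let p be a prime, let Y ⊆ F_p \ {0} be nonempty, let C ⊆ F_p be nonempty, let E = C × C, and assume |Y| ≤ c_1 |C|^2 and |C|^2 |Y| ≤ c_2 p^2. Let N and M be positive real numbers with N^2 M ≤ c_3 · |Y|^{1/4} |C|^{5/2} / E^+(C)^{1/2}. Then there exists y ∈ Y such that for every subset E' ⊆ E with |E'| ≥ |E| / N, we have #{a·y + b : (a, b) ∈ E'} > M. -/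
/-- `addEnergy2 A B` is `E^+(A, B) = #{(a, b, a', b') ∈ A × B × A × B : a + b = a' + b'}`. -/
noncomputable def addEnergy2 {F : Type*} [Add F] (A B : Set F) : ℕ :=
  {t : F × F × F × F | t.1 ∈ A ∧ t.2.1 ∈ B ∧ t.2.2.1 ∈ A ∧ t.2.2.2 ∈ B ∧
      t.1 + t.2.1 = t.2.2.1 + t.2.2.2}.ncard

/-- `addEnergy C` is the additive energy `E^+(C) = E^+(C, C)`. -/
noncomputable def addEnergy {F : Type*} [Add F] (C : Set F) : ℕ := addEnergy2 C C

section

open MvPolynomial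

section Polynomials

variable {K : Type*} [Field K]

/-- Chain rule for a derivation applied to a polynomial expression. -/
lemma derivation_aeval_eq_sum {A : Type*} [CommRing A] [Algebra K A] (D : Derivation K A A)
    {n : ℕ} (f : Fin n → A) (F : MvPolynomial (Fin n) K) :
    D (aeval f F) = ∑ i, aeval f (pderiv i F) * D (f i) := by
  induction F using MvPolynomial.induction_on with
  | C a => simp [algHom_C]
  | add p q hp hq => simp [hp, hq, add_mul, Finset.sum_add_distrib]
  | mul_X p i hp =>
    simp only [map_mul, aeval_X, Derivation.leibniz, hp, smul_eq_mul, map_add, add_mul,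
      Finset.sum_add_distrib, Finset.mul_sum]
    congr 1
    · rw [Finset.sum_eq_single i]
      · simp
      · intro j _ hj
        simp [pderiv_X_of_ne hj.symm]
      · simp
    · exact Finset.sum_congr rfl fun j _ => by ring

lemma totalDegree_pderiv_le {n : ℕ} (i : Fin n) (F : MvPolynomial (Fin n) K) :
    (pderiv i F).totalDegree ≤ F.totalDegree - 1 := by
  refine Finset.sup_le fun m hm => ?_
  rw [mem_support_iff, coeff_pderiv] at hm
  have h1 : m + Finsupp.single i 1 ∈ F.support := by
    rw [mem_support_iff]; exact left_ne_zero_of_mul hm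
  have h2 := le_totalDegree h1
  rw [Finsupp.sum_add_index' (by simp) (by simp)] at h2
  simp at h2
  change (m.sum fun _ e => e) ≤ _
  omega

/-- The restriction of a polynomial in `n` variables to a parametrised line. -/
noncomputable def lineRestrict {n : ℕ} (a b : Fin n → K) (F : MvPolynomial (Fin n) K) :
    Polynomial K :=
  aeval (fun i => Polynomial.C (a i) + Polynomial.C (b i) * Polynomial.X) F

lemma eval_lineRestrict {n : ℕ} (a b : Fin n → K) (F : MvPolynomial (Fin n) K) (s : K) :
    (lineRestrict a b F).eval s = eval (fun i => a i + b i * s) F := by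
  rw [lineRestrict, ← Polynomial.coe_evalRingHom, aeval_def, hom_eval₂]
  have : (Polynomial.evalRingHom s).comp (algebraMap K (Polynomial K)) = RingHom.id K := by
    ext x; simp
  rw [this]
  simp only [eval, eval₂Hom]
  congr 1
  simp

lemma natDegree_lineRestrict_le {n : ℕ} (a b : Fin n → K) (F : MvPolynomial (Fin n) K) :
    (lineRestrict a b F).natDegree ≤ F.totalDegree := by
  have := aeval_natDegree_le (n := 1) F le_rfl
    (fun i => Polynomial.C (a i) + Polynomial.C (b i) * Polynomial.X) (fun i => by compute_degree)
  simpa [lineRestrict] using this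

lemma eval_line_eq_zero_of_card {n : ℕ} (a b : Fin n → K) (F : MvPolynomial (Fin n) K)
    (S : Finset K) (hS : F.totalDegree < S.card)
    (h : ∀ s ∈ S, eval (fun i => a i + b i * s) F = 0) (s : K) :
    eval (fun i => a i + b i * s) F = 0 := by
  rw [← eval_lineRestrict]
  rw [Polynomial.eq_zero_of_natDegree_lt_card_of_eval_eq_zero' (lineRestrict a b F) S
    (fun s hs => by rw [eval_lineRestrict]; exact h s hs)
    ((natDegree_lineRestrict_le a b F).trans_lt hS)]
  simp

lemma eval_directional_pderiv_eq_zero [Infinite K] {n : ℕ} (a b : Fin n → K)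
    (F : MvPolynomial (Fin n) K) (h : ∀ s, eval (fun i => a i + b i * s) F = 0) (s : K) :
    ∑ i, eval (fun i => a i + b i * s) (pderiv i F) * b i = 0 := by
  have h0 : lineRestrict a b F = 0 := by
    refine Polynomial.funext fun s => ?_
    rw [eval_lineRestrict, h, Polynomial.eval_zero]
  have h1 := derivation_aeval_eq_sum (Polynomial.derivative' (R := K))
    (fun i => Polynomial.C (a i) + Polynomial.C (b i) * Polynomial.X) F
  change Polynomial.derivative (lineRestrict a b F) = _ at h1
  rw [h0, Polynomial.derivative_zero] at h1
  have h2 := congrArg (Polynomial.eval s) h1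
  rw [Polynomial.eval_finsetSum] at h2
  simp only [Polynomial.eval_zero, Polynomial.eval_mul] at h2
  rw [h2]
  refine Finset.sum_congr rfl fun i _ => ?_
  rw [← eval_lineRestrict, lineRestrict]
  simp [Polynomial.derivative']

/-- A polynomial in `(t, x)` vanishing on the lines `t = t₀`, `t₀ ∈ T`, has degree at least
`#T`. -/
lemma card_le_totalDegree_of_vanish [Infinite K] (G : MvPolynomial (Fin 2) K) (hG : G ≠ 0)
    (T : Finset K) (h : ∀ t ∈ T, ∀ x, eval ![t, x] G = 0) : T.card ≤ G.totalDegree := by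
  by_contra! hlt
  apply hG
  refine MvPolynomial.funext fun v => ?_
  have hv : ∀ s, (fun i => ![0, v 1] i + ![1, 0] i * s) = ![s, v 1] := fun s => by
    funext i; fin_cases i <;> simp
  have := eval_line_eq_zero_of_card ![0, v 1] ![1, 0] G T hlt
    (fun s hs => by rw [hv]; exact h s hs (v 1)) (v 0)
  rw [map_zero, ← this, hv]
  congr 2
  funext i; fin_cases i <;> simp

/-- Numerator of the second derivative, in the `i`-th direction, of the function implicitly
defined by `F = 0` in terms of the zeroth variable. -/
noncomputable def inflection (i : Fin 3) (F : MvPolynomial (Fin 3) K) : MvPolynomial (Fin 3) K :=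
  pderiv i (pderiv i F) * pderiv 0 F ^ 2
    - (pderiv 0 (pderiv i F) + pderiv i (pderiv 0 F)) * pderiv i F * pderiv 0 F
    + pderiv 0 (pderiv 0 F) * pderiv i F ^ 2

lemma totalDegree_inflection_le (i : Fin 3) (F : MvPolynomial (Fin 3) K) :
    (inflection i F).totalDegree ≤ 3 * F.totalDegree := by
  have h1 : ∀ j, (pderiv j F).totalDegree ≤ F.totalDegree :=
    fun j => (totalDegree_pderiv_le j F).trans (Nat.sub_le _ _)
  have h2 : ∀ j k, (pderiv j (pderiv k F)).totalDegree ≤ F.totalDegree :=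
    fun j k => ((totalDegree_pderiv_le j _).trans (Nat.sub_le _ _)).trans (h1 k)
  have hm : ∀ (A B C : MvPolynomial (Fin 3) K), A.totalDegree ≤ F.totalDegree →
      B.totalDegree ≤ F.totalDegree → C.totalDegree ≤ F.totalDegree →
      (A * B * C).totalDegree ≤ 3 * F.totalDegree := by
    intro A B C hA hB hC
    have h3 := totalDegree_mul (A * B) C
    have h4 := totalDegree_mul A B
    omega
  have ha : (pderiv 0 (pderiv i F) + pderiv i (pderiv 0 F)).totalDegree ≤ F.totalDegree :=
    (totalDegree_add _ _).trans (max_le (h2 _ _) (h2 _ _))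
  rw [inflection, pow_two, pow_two, ← mul_assoc, ← mul_assoc]
  refine (totalDegree_add _ _).trans (max_le ((totalDegree_sub _ _).trans (max_le ?_ ?_)) ?_)
  · exact hm _ _ _ (h2 _ _) (h1 _) (h1 _)
  · exact hm _ _ _ ha (h1 _) (h1 _)
  · exact hm _ _ _ (h2 _ _) (h1 _) (h1 _)

lemma eval_inflection_eq_zero [Infinite K] {i : Fin 3} (hi : i ≠ 0) (F : MvPolynomial (Fin 3) K)
    (a : Fin 3 → K) (m : K)
    (h : ∀ s, eval (fun j => a j + (if j = 0 then m else if j = i then 1 else 0) * s) F = 0)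
    (s : K) :
    eval (fun j => a j + (if j = 0 then m else if j = i then 1 else 0) * s)
      (inflection i F) = 0 := by
  set b : Fin 3 → K := fun j => if j = 0 then m else if j = i then 1 else 0 with hb
  have hsum : ∀ g : Fin 3 → K, ∑ j, g j * b j = g 0 * m + g i := by
    intro g
    rw [Fin.sum_univ_three]
    fin_cases i <;> simp_all
  have h1 : ∀ s, eval (fun j => a j + b j * s) (pderiv 0 F) * m
      + eval (fun j => a j + b j * s) (pderiv i F) = 0 := fun s => by
    rw [← hsum (fun k => eval (fun j => a j + b j * s) (pderiv k F))]
    exact eval_directional_pderiv_eq_zero a b F h s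
  have h2 := eval_directional_pderiv_eq_zero a b (pderiv 0 F * C m + pderiv i F)
    (fun s => by simpa using h1 s) s
  rw [hsum] at h2
  simp only [map_add, Derivation.leibniz, pderiv_C, smul_eq_mul, mul_zero, zero_add, map_mul,
    eval_C] at h2
  have h3 := eq_neg_of_add_eq_zero_right (h1 s)
  simp only [inflection, map_add, map_sub, map_mul, map_pow]
  rw [h3]
  linear_combination (eval (fun j => a j + b j * s) (pderiv 0 F))^2 * h2

end Polynomials

section Vanishing

variable {K : Type*} [Field K]

lemma exists_vanishing_polynomial (P : Finset (Fin 3 → K)) (D : ℕ) (h : P.card < D ^ 3) :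
    ∃ F : MvPolynomial (Fin 3) K, F ≠ 0 ∧ F.totalDegree < 3 * D ∧ ∀ v ∈ P, eval v F = 0 := by
  classical
  have hD : 0 < D := by
    rcases Nat.eq_zero_or_pos D with rfl | h'
    · simp at h
    · exact h'
  let e : (Fin 3 → Fin D) → (Fin 3 →₀ ℕ) :=
    fun m => Finsupp.equivFunOnFinite.symm fun i => (m i : ℕ)
  have he : Function.Injective e := fun m m' hm => by
    funext i
    exact Fin.ext (DFunLike.congr_fun hm i)
  let Φ : ((Fin 3 → Fin D) → K) →ₗ[K] MvPolynomial (Fin 3) K :=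
    Fintype.linearCombination K (fun m => monomial (e m) (1 : K))
  have hΦ : ∀ c, Φ c = ∑ m, c m • monomial (e m) (1 : K) := fun c => by
    simp [Φ, Fintype.linearCombination_apply]
  let Ψ : ((Fin 3 → Fin D) → K) →ₗ[K] (P → K) :=
    (LinearMap.pi fun v : P => (aeval (R := K) (v : Fin 3 → K)).toLinearMap) ∘ₗ Φ
  have hker : LinearMap.ker Ψ ≠ ⊥ := by
    apply LinearMap.ker_ne_bot_of_finrank_lt
    simpa using h
  obtain ⟨c, hc, hc0⟩ := (Submodule.ne_bot_iff _).1 hker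
  refine ⟨Φ c, ?_, ?_, ?_⟩
  · intro h0
    apply hc0
    funext m
    have := congrArg (coeff (e m)) h0
    rw [hΦ, coeff_sum, Finset.sum_eq_single m] at this
    · simpa using this
    · intro m' _ hm'
      rw [coeff_smul, coeff_monomial, if_neg fun h => hm' (he h), smul_zero]
    · simp
  · have : (Φ c).totalDegree ≤ 3 * (D - 1) := by
      rw [hΦ]
      refine totalDegree_finsetSum_le fun m _ => (totalDegree_smul_le _ _).trans ?_
      refine (totalDegree_monomial_le _ _).trans ?_
      rw [Finsupp.sum_fintype _ _ (by simp), Fin.sum_univ_three]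
      have h1 : ∀ i, e m i ≤ D - 1 := fun i => Nat.le_sub_one_of_lt (m i).2
      have := h1 0
      have := h1 1
      have := h1 2
      simp only [id]
      omega
    omega
  · intro v hv
    have := congrFun (LinearMap.mem_ker.1 hc) ⟨v, hv⟩
    simpa [Ψ] using this

/-- The degree of the resultant is at most the product of the numbers of rows and the largest
degree of an entry. -/
lemma totalDegree_resultant_le {n : ℕ} (f g : Polynomial (MvPolynomial (Fin n) K)) (N : ℕ)
    (hf : ∀ i, (f.coeff i).totalDegree ≤ N) (hg : ∀ i, (g.coeff i).totalDegree ≤ N) :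
    (f.resultant g).totalDegree ≤ (f.natDegree + g.natDegree) * N := by
  rw [Polynomial.resultant, Matrix.det_apply]
  refine totalDegree_finsetSum_le fun σ _ => ?_
  have h1 : (∏ i, f.sylvester g f.natDegree g.natDegree (σ i) i).totalDegree
      ≤ (f.natDegree + g.natDegree) * N := by
    refine (totalDegree_finsetProd _ _).trans ?_
    refine (Finset.sum_le_card_nsmul _ _ N fun i _ => ?_).trans (by simp)
    simp only [Polynomial.sylvester, Matrix.of_apply]
    induction i using Fin.addCases with
    | left j =>
      rw [Fin.addCases_left]
      split_ifs
      · exact hg _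
      · simp
    | right j =>
      rw [Fin.addCases_right]
      split_ifs
      · exact hf _
      · simp
  rcases Int.units_eq_one_or (Equiv.Perm.sign σ) with h | h <;> rw [h]
  · simpa using h1
  · simpa using h1

lemma totalDegree_coeff_finSuccEquiv_le {n : ℕ} (F : MvPolynomial (Fin (n + 1)) K) (i : ℕ) :
    ((finSuccEquiv K n F).coeff i).totalDegree ≤ F.totalDegree := by
  by_cases h : (finSuccEquiv K n F).coeff i = 0
  · simp [h]
  · have := totalDegree_coeff_finSuccEquiv_add_le F i h
    omega

/-- An irreducible surface and a surface not containing it have few common lines lying in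
distinct planes `t = const`. -/
lemma card_common_lines_le [Infinite K] (F H : MvPolynomial (Fin 3) K) (hF : Irreducible F)
    (hFH : ¬ F ∣ H) (w : K → K → K) (T : Finset K)
    (hTF : ∀ t ∈ T, ∀ x, eval ![w t x, t, x] F = 0)
    (hTH : ∀ t ∈ T, ∀ x, eval ![w t x, t, x] H = 0) :
    T.card ≤ (F.totalDegree + H.totalDegree) ^ 2 := by
  set f := finSuccEquiv K 2 F with hf
  set h := finSuccEquiv K 2 H with hh
  have hfirr : Irreducible f := (MulEquiv.irreducible_iff (finSuccEquiv K 2)).2 hF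
  have hfh : ¬ f ∣ h := fun hd => hFH ((map_dvd_iff (finSuccEquiv K 2)).1 hd)
  have ev : ∀ (G : MvPolynomial (Fin 3) K) (a t x : K), eval ![a, t, x] G =
      Polynomial.eval a (Polynomial.map (eval ![t, x]) (finSuccEquiv K 2 G)) := fun G a t x => by
    rw [← eval_eq_eval_mv_eval']
    rfl
  rcases Nat.eq_zero_or_pos f.natDegree with h0 | h0
  · have hc := Polynomial.eq_C_of_natDegree_eq_zero h0
    have h1 : T.card ≤ (f.coeff 0).totalDegree := by
      refine card_le_totalDegree_of_vanish _ ?_ T fun t ht x => ?_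
      · intro h2
        rw [h2, map_zero] at hc
        exact hfirr.ne_zero hc
      · have := hTF t ht x
        rw [ev, ← hf, hc] at this
        simpa using this
    have h2 := totalDegree_coeff_finSuccEquiv_le F 0
    rw [← hf] at h2
    have h3 := Nat.le_self_pow two_ne_zero (F.totalDegree + H.totalDegree)
    omega
  · let L := FractionRing (MvPolynomial (Fin 2) K)
    have hinj : Function.Injective (algebraMap (MvPolynomial (Fin 2) K) L) :=
      IsFractionRing.injective _ _
    let _ : NormalizedGCDMonoid (MvPolynomial (Fin 2) K) :=
      Classical.choice (inferInstance : Nonempty _)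
    have hprim : f.IsPrimitive := hfirr.isPrimitive h0.ne'
    have hmap : Irreducible (f.map (algebraMap _ L)) :=
      (hprim.irreducible_iff_irreducible_map_fraction_map).1 hfirr
    have hnd : ¬ f.map (algebraMap _ L) ∣ h.map (algebraMap _ L) := fun hd =>
      hfh (hprim.dvd_of_fraction_map_dvd_fraction_map hd)
    have hcop : IsCoprime (f.map (algebraMap _ L)) (h.map (algebraMap _ L)) :=
      (hmap.coprime_iff_not_dvd).2 hnd
    have hres : f.resultant h ≠ 0 := by
      intro h1
      apply Polynomial.resultant_ne_zero _ _ hcop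
      rw [Polynomial.natDegree_map_eq_of_injective hinj,
        Polynomial.natDegree_map_eq_of_injective hinj, Polynomial.resultant_map_map, h1, map_zero]
    obtain ⟨a, b, -, -, hab⟩ := Polynomial.exists_mul_add_mul_eq_C_resultant f h le_rfl le_rfl
      (Or.inl h0.ne')
    have h1 : T.card ≤ (f.resultant h).totalDegree := by
      refine card_le_totalDegree_of_vanish _ hres T fun t ht x => ?_
      have h2 := congrArg
        (fun g => Polynomial.eval (w t x) (Polynomial.map (eval ![t, x]) g)) hab
      simp only [Polynomial.map_add, Polynomial.map_mul, Polynomial.eval_add,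
        Polynomial.eval_mul, Polynomial.map_C, Polynomial.eval_C] at h2
      rw [← h2, hf, hh, ← ev, ← ev, hTF t ht x, hTH t ht x]
      ring
    have h2 : f.natDegree ≤ F.totalDegree := by
      rw [hf, natDegree_finSuccEquiv]
      exact degreeOf_le_totalDegree _ _
    have h3 : h.natDegree ≤ H.totalDegree := by
      rw [hh, natDegree_finSuccEquiv]
      exact degreeOf_le_totalDegree _ _
    have h4 := totalDegree_resultant_le f h (F.totalDegree + H.totalDegree)
      (fun i => (totalDegree_coeff_finSuccEquiv_le F i).trans (Nat.le_add_right _ _))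
      (fun i => (totalDegree_coeff_finSuccEquiv_le H i).trans (Nat.le_add_left _ _))
    calc T.card ≤ _ := h1
      _ ≤ _ := h4
      _ ≤ (F.totalDegree + H.totalDegree) * (F.totalDegree + H.totalDegree) := by gcongr
      _ = _ := (sq _).symm

end Vanishing

section Truncation

variable {K : Type*} [Field K]

/-- The ideal generated by the `p`-th powers of the variables. -/
noncomputable def truncIdeal (K : Type*) [Field K] (p : ℕ) : Ideal (MvPolynomial (Fin 2) K) :=
  Ideal.span ((fun s => monomial s (1 : K)) ''
    ({Finsupp.single 0 p, Finsupp.single 1 p} : Set (Fin 2 →₀ ℕ)))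

lemma mem_truncIdeal_iff (p : ℕ) (f : MvPolynomial (Fin 2) K) :
    f ∈ truncIdeal K p ↔ ∀ m : Fin 2 →₀ ℕ, m 0 < p → m 1 < p → coeff m f = 0 := by
  rw [truncIdeal, mem_ideal_span_monomial_image]
  constructor
  · intro h m h0 h1
    by_contra hm
    obtain ⟨s, hs, hsm⟩ := h m (mem_support_iff.2 hm)
    rcases hs with rfl | rfl
    · have := hsm 0
      simp at this
      omega
    · have := hsm 1
      simp at this
      omega
  · intro h m hm
    by_contra! hc
    refine mem_support_iff.1 hm (h m ?_ ?_)
    · by_contra! h0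
      exact hc (Finsupp.single 0 p) (by simp) (by simpa using h0)
    · by_contra! h0
      exact hc (Finsupp.single 1 p) (by simp) (by simpa using h0)

lemma pderiv_mem_truncIdeal (p : ℕ) [CharP K p] (i : Fin 2) {f : MvPolynomial (Fin 2) K}
    (hf : f ∈ truncIdeal K p) : pderiv i f ∈ truncIdeal K p := by
  rw [mem_truncIdeal_iff] at hf ⊢
  intro m h0 h1
  rw [coeff_pderiv]
  by_cases hp : m i + 1 = p
  · have : ((m i : K) + 1) = 0 := by
      have := CharP.cast_eq_zero K p
      rw [← hp] at this
      exact_mod_cast this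
    simp [this]
  · rw [hf, zero_mul]
    · fin_cases i <;> simp_all
      omega
    · fin_cases i <;> simp_all
      omega

lemma isNilpotent_mk_of_constantCoeff_eq_zero (p : ℕ) (f : MvPolynomial (Fin 2) K)
    (hf : constantCoeff f = 0) : IsNilpotent (Ideal.Quotient.mk (truncIdeal K p) f) := by
  have hX : ∀ i, IsNilpotent (Ideal.Quotient.mk (truncIdeal K p) (X i)) := fun i => by
    refine ⟨p, ?_⟩
    rw [← map_pow, Ideal.Quotient.eq_zero_iff_mem, X_pow_eq_monomial]
    refine Ideal.subset_span ⟨_, ?_, rfl⟩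
    fin_cases i <;> simp
  have key : ∀ g : MvPolynomial (Fin 2) K,
      IsNilpotent (Ideal.Quotient.mk (truncIdeal K p) (g - C (constantCoeff g))) := by
    intro g
    induction g using MvPolynomial.induction_on with
    | C a => simp
    | add g h hg hh =>
      have := Commute.isNilpotent_add (Commute.all _ _) hg hh
      rwa [← map_add, show g - C (constantCoeff g) + (h - C (constantCoeff h))
        = g + h - C (constantCoeff (g + h)) by rw [map_add constantCoeff, C_add]; ring] at this
    | mul_X g i _ =>
      simp only [map_mul, constantCoeff_X, mul_zero, map_zero, sub_zero]
      exact Commute.isNilpotent_mul_left (Commute.all _ _) (hX i)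
  simpa [hf] using key f

lemma isUnit_mk_of_constantCoeff_ne_zero (p : ℕ) (f : MvPolynomial (Fin 2) K)
    (hf : constantCoeff f ≠ 0) : IsUnit (Ideal.Quotient.mk (truncIdeal K p) f) := by
  have h1 := isNilpotent_mk_of_constantCoeff_eq_zero p (f - C (constantCoeff f)) (by simp)
  have h2 : IsUnit (Ideal.Quotient.mk (truncIdeal K p) (C (constantCoeff f))) :=
    ((isUnit_iff_ne_zero.2 hf).map C).map _
  have := h1.isUnit_add_left_of_commute h2 (Commute.all _ _)
  simpa using this

lemma degreeOf_aeval_le {n k : ℕ} (i : Fin k) (f : Fin n → MvPolynomial (Fin k) K)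
    (hf : ∀ j, degreeOf i (f j) ≤ 1) (F : MvPolynomial (Fin n) K) :
    degreeOf i (aeval f F) ≤ F.totalDegree := by
  rw [aeval_def, eval₂_eq]
  refine (degreeOf_sum_le _ _ _).trans (Finset.sup_le fun m hm => ?_)
  rw [algebraMap_eq]
  refine (degreeOf_C_mul_le _ _ _).trans ((degreeOf_prod_le _ _ _).trans ?_)
  refine le_trans (Finset.sum_le_sum fun j _ => ?_) (le_totalDegree hm)
  exact (degreeOf_pow_le _ _ _).trans (by simpa using Nat.mul_le_mul_left (m j) (hf j))

/-- Implicit function theorem modulo `p`-th powers. -/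
lemma exists_root_mod_truncIdeal (p : ℕ) (F : MvPolynomial (Fin 3) K) (w t x : K)
    (hF : eval ![w, t, x] F = 0) (hF' : eval ![w, t, x] (pderiv 0 F) ≠ 0) :
    ∃ W : MvPolynomial (Fin 2) K, aeval ![W, C t + X 0, C x + X 1] F ∈ truncIdeal K p ∧
      IsUnit (Ideal.Quotient.mk (truncIdeal K p)
        (aeval ![W, C t + X 0, C x + X 1] (pderiv 0 F))) := by
  set S := MvPolynomial (Fin 2) K ⧸ truncIdeal K p
  set π := Ideal.Quotient.mk (truncIdeal K p) with hπ
  let P : Polynomial (MvPolynomial (Fin 2) K) :=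
    aeval ![Polynomial.X, Polynomial.C (C t + X 0), Polynomial.C (C x + X 1)] F
  have evP : ∀ (G : MvPolynomial (Fin 3) K) (W : MvPolynomial (Fin 2) K),
      Polynomial.aeval (π W) (aeval ![Polynomial.X, Polynomial.C (C t + X 0),
        Polynomial.C (C x + X 1)] G : Polynomial (MvPolynomial (Fin 2) K))
      = π (aeval ![W, C t + X 0, C x + X 1] G) := by
    intro G W
    induction G using MvPolynomial.induction_on with
    | C a =>
      simp only [algHom_C]
      rw [IsScalarTower.algebraMap_apply K (MvPolynomial (Fin 2) K) (Polynomial _),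
        Polynomial.algebraMap_eq, Polynomial.aeval_C]
      rfl
    | add g h hg hh =>
      generalize (![Polynomial.X, Polynomial.C (C t + X 0), Polynomial.C (C x + X 1)] :
        Fin 3 → Polynomial (MvPolynomial (Fin 2) K)) = v at hg hh ⊢
      simp only [map_add, hg, hh]
    | mul_X g i hg =>
      simp only [map_mul, aeval_X, hg]
      congr 1
      fin_cases i
      · simp
      · simp only [Fin.mk_one, Matrix.cons_val_one, Matrix.cons_val_zero, Polynomial.aeval_C]
        rfl
      · simp only [Fin.reduceFinMk, Matrix.cons_val, Polynomial.aeval_C]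
        rfl
  have hder : Polynomial.derivative P = aeval ![Polynomial.X, Polynomial.C (C t + X 0),
        Polynomial.C (C x + X 1)] (pderiv 0 F) := by
    have := derivation_aeval_eq_sum
      ((Polynomial.derivative' (R := MvPolynomial (Fin 2) K)).restrictScalars K)
      ![Polynomial.X, Polynomial.C (C t + X 0), Polynomial.C (C x + X 1)] F
    change Polynomial.derivative P = _ at this
    rw [this, Fin.sum_univ_three]
    simp [Polynomial.derivative']
  have cc : ∀ (G : MvPolynomial (Fin 3) K) (W : MvPolynomial (Fin 2) K),
      constantCoeff (aeval ![W, C t + X 0, C x + X 1] G)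
        = eval ![constantCoeff W, t, x] G := by
    intro G W
    induction G using MvPolynomial.induction_on with
    | C a => simp
    | add g h hg hh => simp only [map_add, hg, hh]
    | mul_X g i hg =>
      simp only [map_mul, aeval_X, eval_X, hg]
      congr 1
      fin_cases i <;> simp
  obtain ⟨r, ⟨hr, hr0⟩, -⟩ := Polynomial.existsUnique_nilpotent_sub_and_aeval_eq_zero
    (P := P) (x := π (C w))
    (by rw [evP]; exact isNilpotent_mk_of_constantCoeff_eq_zero p _ (by rw [cc]; simpa using hF))
    (by rw [hder, evP]
        exact isUnit_mk_of_constantCoeff_ne_zero p _ (by rw [cc]; simpa using hF'))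
  obtain ⟨W, rfl⟩ := Ideal.Quotient.mk_surjective r
  refine ⟨W, ?_, ?_⟩
  · rw [← Ideal.Quotient.eq_zero_iff_mem, ← hr0]
    exact (evP F W).symm
  · rw [← evP]
    have h1 := Polynomial.isNilpotent_aeval_sub_of_isNilpotent_sub
      (Polynomial.derivative P) (by simpa using hr.neg : IsNilpotent (π W - π (C w)))
    have h2 : IsUnit (Polynomial.aeval (π (C w)) (Polynomial.derivative P)) := by
      rw [hder, evP]
      exact isUnit_mk_of_constantCoeff_ne_zero p _ (by rw [cc]; simpa using hF')
    have h3 := h1.isUnit_add_left_of_commute h2 (Commute.all _ _)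
    rw [← hder]
    simpa using h3

/-- If the second derivative in the `i`-th direction of the root `W` of `F` is governed by a
multiple of `F`, then `W` is affine in the `i`-th direction modulo `p`-th powers. -/
lemma pderiv_pderiv_mem_truncIdeal (p : ℕ) [CharP K p] (F : MvPolynomial (Fin 3) K)
    (v : Fin 3 → MvPolynomial (Fin 2) K) (i : Fin 2)
    (hv : ∀ j : Fin 2, pderiv i (v j.succ) = if j = i then 1 else 0)
    (hF : aeval v F ∈ truncIdeal K p)
    (hF' : IsUnit (Ideal.Quotient.mk (truncIdeal K p) (aeval v (pderiv 0 F))))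
    (hd : F ∣ inflection i.succ F) : pderiv i (pderiv i (v 0)) ∈ truncIdeal K p := by
  have hsum : ∀ g : Fin 3 → MvPolynomial (Fin 2) K,
      ∑ j, g j * pderiv i (v j) = g 0 * pderiv i (v 0) + g i.succ := by
    intro g
    rw [Fin.sum_univ_succ]
    simp [hv]
  have h1 := pderiv_mem_truncIdeal p i hF
  rw [derivation_aeval_eq_sum, hsum] at h1
  have h2 := pderiv_mem_truncIdeal p i h1
  rw [map_add, Derivation.leibniz, derivation_aeval_eq_sum, derivation_aeval_eq_sum, hsum, hsum,
    smul_eq_mul, smul_eq_mul] at h2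
  have h3 : aeval v (inflection i.succ F) ∈ truncIdeal K p := by
    obtain ⟨G, hG⟩ := hd
    rw [hG, map_mul]
    exact Ideal.mul_mem_right _ _ hF
  rw [← Ideal.Quotient.eq_zero_iff_mem] at h1 h2 h3 ⊢
  simp only [inflection, map_add, map_sub, map_mul, map_pow] at h1 h2 h3
  have h4 := eq_neg_of_add_eq_zero_right h1
  rw [h4] at h3
  refine (hF'.pow 3).mul_left_cancel ?_
  linear_combination (Ideal.Quotient.mk (truncIdeal K p) (aeval v (pderiv 0 F)))^2 * h2 - h3

lemma coeff_eq_zero_of_pderiv_pderiv_mem (p : ℕ) [Fact p.Prime] [CharP K p] (i : Fin 2)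
    {f : MvPolynomial (Fin 2) K} (hf : pderiv i (pderiv i f) ∈ truncIdeal K p)
    (m : Fin 2 →₀ ℕ) (h0 : m 0 < p) (h1 : m 1 < p) (hi : 2 ≤ m i) : coeff m f = 0 := by
  rw [mem_truncIdeal_iff] at hf
  have hm : m - Finsupp.single i 2 + Finsupp.single i 1 + Finsupp.single i 1 = m := by
    rw [add_assoc, ← Finsupp.single_add]
    exact tsub_add_cancel_of_le (by simpa using hi)
  have h2 := hf (m - Finsupp.single i 2) (lt_of_le_of_lt (by simp) h0)
    (lt_of_le_of_lt (by simp) h1)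
  rw [coeff_pderiv, coeff_pderiv, hm] at h2
  have hp : m i < p := by fin_cases i <;> assumption
  have hne : ∀ k : ℕ, 0 < k → k < p → (k : K) ≠ 0 := fun k hk hkp h =>
    absurd (Nat.le_of_dvd hk ((CharP.cast_eq_zero_iff K p k).1 h)) (not_le.2 hkp)
  have e1 := hne (m i - 1) (by omega) (by omega)
  have e2 := hne (m i) (by omega) hp
  rw [mul_eq_zero, mul_eq_zero] at h2
  rcases h2 with (h2 | h2) | h2
  · exact h2
  · exfalso
    apply e2
    rw [← h2, show m i = (m i - 2) + 1 + 1 by omega]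
    simp
  · exfalso
    apply e1
    rw [← h2, show m i - 1 = (m i - 2) + 1 by omega]
    simp

/-- A surface `F = 0` of degree less than the characteristic, all of whose points are inflection
points in the two coordinate directions, contains the graph of a bilinear function. -/
lemma exists_bilinear_root (p : ℕ) [Fact p.Prime] [CharP K p] (F : MvPolynomial (Fin 3) K)
    (hdeg : F.totalDegree < p) (hd1 : F ∣ inflection 1 F) (hd2 : F ∣ inflection 2 F)
    (w t₀ x₀ : K) (hF : eval ![w, t₀, x₀] F = 0) (hF' : eval ![w, t₀, x₀] (pderiv 0 F) ≠ 0) :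
    ∃ A B C D : K, ∀ t x, eval ![A + B * t + C * x + D * t * x, t, x] F = 0 := by
  obtain ⟨W, hW, hU⟩ := exists_root_mod_truncIdeal p F w t₀ x₀ hF hF'
  have hW0 := pderiv_pderiv_mem_truncIdeal p F _ 0
    (fun j => by fin_cases j <;> simp) hW hU hd1
  have hW1 := pderiv_pderiv_mem_truncIdeal p F _ 1
    (fun j => by fin_cases j <;> simp) hW hU hd2
  simp only [Matrix.cons_val_zero] at hW0 hW1
  set a := coeff 0 W
  set b := coeff (Finsupp.single 0 1) W
  set c := coeff (Finsupp.single 1 1) W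
  set d := coeff (Finsupp.single 0 1 + Finsupp.single 1 1) W
  set q : MvPolynomial (Fin 2) K := C a + C b * X 0 + C c * X 1 + C d * X 0 * X 1 with hq
  have hqm : q = monomial 0 a + monomial (Finsupp.single 0 1) b + monomial (Finsupp.single 1 1) c
      + monomial (Finsupp.single 0 1 + Finsupp.single 1 1) d := by
    rw [hq, C_mul_X_eq_monomial, C_mul_X_eq_monomial, C_mul_X_eq_monomial, X, monomial_mul,
      mul_one]
    rfl
  have hWq : W - q ∈ truncIdeal K p := by
    rw [mem_truncIdeal_iff]
    intro m h0 h1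
    rw [coeff_sub, hqm]
    simp only [coeff_add, coeff_monomial]
    by_cases h2 : 2 ≤ m 0
    · rw [coeff_eq_zero_of_pderiv_pderiv_mem p 0 hW0 m h0 h1 h2]
      have e : ∀ n : Fin 2 →₀ ℕ, n 0 < 2 → n ≠ m := fun n hn h => by subst h; omega
      rw [if_neg (e _ (by simp)), if_neg (e _ (by simp)), if_neg (e _ (by simp)),
        if_neg (e _ (by simp))]
      simp
    by_cases h3 : 2 ≤ m 1
    · rw [coeff_eq_zero_of_pderiv_pderiv_mem p 1 hW1 m h0 h1 h3]
      have e : ∀ n : Fin 2 →₀ ℕ, n 1 < 2 → n ≠ m := fun n hn h => by subst h; omega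
      rw [if_neg (e _ (by simp)), if_neg (e _ (by simp)), if_neg (e _ (by simp)),
        if_neg (e _ (by simp))]
      simp
    have hm : m = Finsupp.single 0 (m 0) + Finsupp.single 1 (m 1) := by
      ext i; fin_cases i <;> simp
    have ext2 : ∀ m n : Fin 2 →₀ ℕ, m = n ↔ m 0 = n 0 ∧ m 1 = n 1 := fun m n =>
      ⟨fun h => by simp [h], fun h => by ext i; fin_cases i; exacts [h.1, h.2]⟩
    have e0 : m 0 = 0 ∨ m 0 = 1 := by omega
    have e1 : m 1 = 0 ∨ m 1 = 1 := by omega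
    rcases e0 with e0 | e0 <;> rcases e1 with e1 | e1 <;>
      (rw [hm, e0, e1]; simp [ext2, a, b, c, d])
  have hq0 : aeval ![q, C t₀ + X 0, C x₀ + X 1] F ∈ truncIdeal K p := by
    have e : ∀ V : MvPolynomial (Fin 2) K,
        Ideal.Quotient.mk (truncIdeal K p) (aeval ![V, C t₀ + X 0, C x₀ + X 1] F)
        = aeval ![Ideal.Quotient.mk (truncIdeal K p) V,
            Ideal.Quotient.mk (truncIdeal K p) (C t₀ + X 0),
            Ideal.Quotient.mk (truncIdeal K p) (C x₀ + X 1)] F := fun V => by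
      have := comp_aeval_apply (σ := Fin 3) (R := K) ![V, C t₀ + X 0, C x₀ + X 1]
        (Ideal.Quotient.mkₐ K (truncIdeal K p)) F
      rw [Ideal.Quotient.mkₐ_eq_mk] at this
      rw [this]
      congr 2
      funext i
      fin_cases i <;> rfl
    rw [← Ideal.Quotient.eq_zero_iff_mem] at hW ⊢
    rw [e] at hW ⊢
    rw [← Ideal.Quotient.mk_eq_mk_iff_sub_mem] at hWq
    rwa [← hWq]
  have hdq : ∀ i j, degreeOf i ((![q, C t₀ + X 0, C x₀ + X 1] :
      Fin 3 → MvPolynomial (Fin 2) K) j) ≤ 1 := by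
    intro i j
    have hmon : ∀ (m : Fin 2 →₀ ℕ) (u : K), m i ≤ 1 → degreeOf i (monomial m u) ≤ 1 := by
      intro m u hm
      by_cases hu : u = 0
      · simp [hu]
      · rwa [degreeOf_monomial_eq _ _ hu]
    have hadd : ∀ f g : MvPolynomial (Fin 2) K, degreeOf i f ≤ 1 → degreeOf i g ≤ 1 →
        degreeOf i (f + g) ≤ 1 := fun f g hf hg =>
      (degreeOf_add_le _ _ _).trans (max_le hf hg)
    fin_cases j
    · change degreeOf i q ≤ 1
      rw [hqm]
      refine hadd _ _ (hadd _ _ (hadd _ _ (hmon _ _ ?_) (hmon _ _ ?_)) (hmon _ _ ?_))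
        (hmon _ _ ?_) <;> fin_cases i <;> simp
    · refine hadd _ _ (by simp) (hmon _ _ ?_)
      fin_cases i <;> simp
    · refine hadd _ _ (by simp) (hmon _ _ ?_)
      fin_cases i <;> simp
  have hΦ : aeval ![q, C t₀ + X 0, C x₀ + X 1] F = 0 := by
    ext m
    rw [coeff_zero]
    by_contra hm
    apply hm
    have hmi : ∀ i, m i < p := fun i =>
      ((monomial_le_degreeOf i (mem_support_iff.2 hm)).trans
        (degreeOf_aeval_le i _ (hdq i) F)).trans_lt hdeg
    exact (mem_truncIdeal_iff p _).1 hq0 m (hmi 0) (hmi 1)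
  refine ⟨a - b * t₀ - c * x₀ + d * t₀ * x₀, b - d * x₀, c - d * t₀, d, fun t x => ?_⟩
  have h := congrArg (aeval (R := K) ![t - t₀, x - x₀]) hΦ
  rw [comp_aeval_apply, map_zero] at h
  rw [← coe_aeval_eq_eval, ← h]
  change aeval _ F = _
  congr 2
  funext i
  fin_cases i
  · simp [hq]
    ring
  · simp
  · simp

end Truncation

section Regulus

variable {K : Type*} [Field K]

lemma eval_eq_eval_map_finSuccEquiv (G : MvPolynomial (Fin 3) K) (w t x : K) :
    eval ![w, t, x] G =
      Polynomial.eval w (Polynomial.map (eval ![t, x]) (finSuccEquiv K 2 G)) := by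
  rw [← eval_eq_eval_mv_eval']
  rfl

lemma eq_of_eval_eq_zero_of_root [Infinite K] (F : MvPolynomial (Fin 3) K) (hF : Irreducible F)
    (q : MvPolynomial (Fin 2) K) (hq : ∀ t x, eval ![eval ![t, x] q, t, x] F = 0)
    {w t x : K} (h : eval ![w, t, x] F = 0) : w = eval ![t, x] q := by
  have hroot : (finSuccEquiv K 2 F).IsRoot q := by
    refine MvPolynomial.funext fun v => ?_
    have hv : v = ![v 0, v 1] := by funext i; fin_cases i <;> rfl
    rw [hv, map_zero, ← hq (v 0) (v 1), eval_eq_eval_map_finSuccEquiv, Polynomial.eval_map,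
      Polynomial.eval₂_hom]
  obtain ⟨u, hu⟩ := Polynomial.dvd_iff_isRoot.2 hroot
  have hirr : Irreducible (finSuccEquiv K 2 F) :=
    (MulEquiv.irreducible_iff (finSuccEquiv K 2)).2 hF
  have hunit : IsUnit u := (hirr.isUnit_or_isUnit hu).resolve_left
    (Polynomial.not_isUnit_X_sub_C q)
  rw [eval_eq_eval_map_finSuccEquiv, hu, Polynomial.map_mul, Polynomial.eval_mul] at h
  have hunit' : IsUnit (Polynomial.eval w (Polynomial.map (eval ![t, x]) u)) :=
    (hunit.map (Polynomial.mapRingHom (eval ![t, x]))).map (Polynomial.evalRingHom w)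
  have := (mul_eq_zero.1 h).resolve_right hunit'.ne_zero
  simpa [sub_eq_zero] using this

lemma notMem_vars_of_pderiv_eq_zero {n : ℕ} (p : ℕ) [CharP K p] (i : Fin n)
    (F : MvPolynomial (Fin n) K) (hdeg : F.totalDegree < p) (h : pderiv i F = 0) :
    i ∉ F.vars := by
  intro hi
  obtain ⟨m, hm, hmi⟩ := (mem_vars_iff_mem_support i).1 hi
  rw [Finsupp.mem_support_iff] at hmi
  have hm1 : m - Finsupp.single i 1 + Finsupp.single i 1 = m :=
    tsub_add_cancel_of_le (by simpa using Nat.one_le_iff_ne_zero.2 hmi)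
  have h1 := congrArg (coeff (m - Finsupp.single i 1)) h
  rw [coeff_pderiv, hm1, coeff_zero, mul_eq_zero] at h1
  have h2 := h1.resolve_left (mem_support_iff.1 hm)
  have h3 : ((m i : ℕ) : K) = 0 := by
    rw [← h2, show m i = (m i - 1) + 1 by omega]
    simp
  have h4 := Nat.le_of_dvd (Nat.pos_of_ne_zero hmi) ((CharP.cast_eq_zero_iff K p _).1 h3)
  have h5 : m i ≤ F.totalDegree :=
    (monomial_le_degreeOf i hm).trans (degreeOf_le_totalDegree _ _)
  omega

/-- An irreducible surface of low degree, containing many lines in the planes `t = const` along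
which it is flat in the `t` direction, contains only lines of a fixed regulus in the planes
`x = const`. -/
lemma exists_regulus [Infinite K] (p : ℕ) [Fact p.Prime] [CharP K p]
    (F : MvPolynomial (Fin 3) K) (hF : Irreducible F) (hdeg : F.totalDegree < p)
    (Z Y α γ : K → K) (X T : Finset K) (hT : 16 * F.totalDegree ^ 2 < T.card)
    (hTF : ∀ t ∈ T, ∀ x, eval ![γ t + x * α t, t, x] F = 0)
    (hTi : ∀ t ∈ T, ∀ x, eval ![γ t + x * α t, t, x] (inflection 1 F) = 0)
    (hXF : ∀ x ∈ X, ∀ t, eval ![Z x + t * Y x, t, x] F = 0) :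
    ∃ A B C D : K, ∀ x ∈ X, Y x = B + D * x ∧ Z x = A + C * x := by
  have hd1 : F ∣ inflection 1 F := by
    by_contra hnd
    have h1 := card_common_lines_le F _ hF hnd (fun t x => γ t + x * α t) T hTF hTi
    have h2 := Nat.pow_le_pow_left
      (Nat.add_le_add_left (totalDegree_inflection_le 1 F) F.totalDegree) 2
    nlinarith
  have hd2 : F ∣ inflection 2 F := by
    by_contra hnd
    have h1 := card_common_lines_le F _ hF hnd (fun t x => γ t + x * α t) T hTF (by
      intro t ht x
      have hv : ∀ s : K, (fun j : Fin 3 => ![γ t, t, 0] j +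
          (if j = 0 then α t else if j = 2 then 1 else 0) * s) = ![γ t + s * α t, t, s] := by
        intro s
        funext j
        fin_cases j <;> simp [mul_comm]
      have := eval_inflection_eq_zero (i := 2) (by decide) F ![γ t, t, 0] (α t)
        (fun s => by rw [hv]; exact hTF t ht s) x
      rwa [hv] at this)
    have h2 := Nat.pow_le_pow_left
      (Nat.add_le_add_left (totalDegree_inflection_le 2 F) F.totalDegree) 2
    nlinarith
  have hd0 : ¬ F ∣ pderiv 0 F := by
    intro hdvd
    have h0 : pderiv 0 F = 0 := by
      by_contra hne
      have h1 := totalDegree_le_of_dvd_of_isDomain hdvd hne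
      have h2 := totalDegree_pderiv_le 0 F
      have h3 : F.totalDegree = 0 := by omega
      rw [totalDegree_eq_zero_iff_eq_C] at h3
      rw [h3, pderiv_C] at hne
      exact hne rfl
    have hvars := notMem_vars_of_pderiv_eq_zero p 0 F hdeg h0
    have hindep : ∀ w w' t x : K, eval ![w, t, x] F = eval ![w', t, x] F := by
      intro w w' t x
      refine eval₂Hom_congr' rfl (fun i hi _ => ?_) rfl
      fin_cases i
      · exact absurd hi hvars
      · rfl
      · rfl
    apply hF.ne_zero
    refine MvPolynomial.funext fun v => ?_
    have hv : ∀ s, (fun j : Fin 3 => ![v 0, 0, v 2] j + ![0, 1, 0] j * s) = ![v 0, s, v 2] := by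
      intro s
      funext j
      fin_cases j <;> simp
    have h1 := eval_line_eq_zero_of_card ![v 0, 0, v 2] ![0, 1, 0] F T (by nlinarith)
      (fun s hs => by rw [hv, hindep _ (γ s + v 2 * α s)]; exact hTF s hs _) (v 1)
    rw [hv] at h1
    rw [map_zero, ← h1]
    congr 2
    funext j
    fin_cases j <;> rfl
  obtain ⟨t, ht, x, hx⟩ : ∃ t ∈ T, ∃ x, eval ![γ t + x * α t, t, x] (pderiv 0 F) ≠ 0 := by
    by_contra! hcon
    have h1 := card_common_lines_le F _ hF hd0 (fun t x => γ t + x * α t) T hTF hcon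
    have h2 := totalDegree_pderiv_le 0 F
    have h3 : (F.totalDegree + (pderiv 0 F).totalDegree) ^ 2
        ≤ (F.totalDegree + F.totalDegree) ^ 2 := Nat.pow_le_pow_left (by omega) 2
    nlinarith
  obtain ⟨A, B, E, D, h⟩ := exists_bilinear_root p F hdeg hd1 hd2 _ _ _ (hTF t ht x) hx
  refine ⟨A, B, E, D, fun x hx => ?_⟩
  have hq : ∀ t x, eval ![t, x] (C A + C B * MvPolynomial.X 0 + C E * MvPolynomial.X 1 + C D * MvPolynomial.X 0 *
      MvPolynomial.X 1 :
      MvPolynomial (Fin 2) K) = A + B * t + E * x + D * t * x := by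
    intro t x
    simp
  have key := fun t => eq_of_eval_eq_zero_of_root F hF
    (C A + C B * MvPolynomial.X 0 + C E * MvPolynomial.X 1 + C D * MvPolynomial.X 0 *
      MvPolynomial.X 1) (fun t x => by rw [hq]; exact h t x)
    (hXF x hx t)
  have k0 := key 0
  have k1 := key 1
  rw [hq] at k0 k1
  constructor
  · linear_combination k1 - k0
  · linear_combination k0

end Regulus

section Incidences

/-- The number of pairs of `X × T` related by `r`. -/
noncomputable def numInc {ι κ : Type*} (r : ι → κ → Prop) (X : Finset ι) (T : Finset κ) : ℕ :=
  open scoped Classical in ((X ×ˢ T).filter fun q => r q.1 q.2).card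

open scoped Classical in
lemma numInc_eq_sum_left {ι κ : Type*} (r : ι → κ → Prop) (X : Finset ι) (T : Finset κ) :
    numInc r X T = ∑ x ∈ X, (T.filter fun t => r x t).card := by
  simp only [numInc, Finset.card_filter, Finset.sum_product]

lemma numInc_flip {ι κ : Type*} (r : ι → κ → Prop) (X : Finset ι) (T : Finset κ) :
    numInc (fun t x => r x t) T X = numInc r X T := by
  classical
  simp only [numInc, Finset.card_filter, Finset.sum_product]
  exact Finset.sum_comm

open scoped Classical in
lemma numInc_le_left {ι κ : Type*} (r : ι → κ → Prop) (X : Finset ι) (T : Finset κ) (d : ℕ)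
    (h : ∀ x ∈ X, (T.filter fun t => r x t).card ≤ d) : numInc r X T ≤ d * X.card := by
  rw [numInc_eq_sum_left, mul_comm]
  simpa using Finset.sum_le_card_nsmul X _ d h

open scoped Classical in
lemma numInc_le_right {ι κ : Type*} (r : ι → κ → Prop) (X : Finset ι) (T : Finset κ) (d : ℕ)
    (h : ∀ t ∈ T, (X.filter fun x => r x t).card ≤ d) : numInc r X T ≤ d * T.card := by
  rw [← numInc_flip]
  exact numInc_le_left _ T X d h

lemma numInc_le_mul {ι κ : Type*} (r : ι → κ → Prop) (X : Finset ι) (T : Finset κ) :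
    numInc r X T ≤ X.card * T.card := by
  classical
  exact numInc_le_right r X T X.card fun t _ => Finset.card_filter_le _ _

open scoped Classical in
lemma numInc_split_left {ι κ : Type*} (r : ι → κ → Prop) (X : Finset ι) (T : Finset κ)
    (P : ι → Prop) :
    numInc r X T = numInc r (X.filter P) T + numInc r (X.filter fun x => ¬ P x) T := by
  simp only [numInc_eq_sum_left]
  exact (Finset.sum_filter_add_sum_filter_not X P _).symm

open scoped Classical in
lemma numInc_split_right {ι κ : Type*} (r : ι → κ → Prop) (X : Finset ι) (T : Finset κ)
    (P : κ → Prop) :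
    numInc r X T = numInc r X (T.filter P) + numInc r X (T.filter fun x => ¬ P x) := by
  rw [← numInc_flip, numInc_split_left _ T X P, numInc_flip r, numInc_flip r]

end Incidences

section Components

variable {K : Type*} [Field K]

lemma eval_line_mul_eq_zero [Infinite K] {n : ℕ} (a b : Fin n → K) (F G : MvPolynomial (Fin n) K)
    (h : ∀ s, eval (fun i => a i + b i * s) (F * G) = 0)
    (hF : ¬ ∀ s, eval (fun i => a i + b i * s) F = 0) (s : K) :
    eval (fun i => a i + b i * s) G = 0 := by
  have h1 : lineRestrict a b F * lineRestrict a b G = 0 := by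
    refine Polynomial.funext fun s => ?_
    rw [Polynomial.eval_mul, eval_lineRestrict, eval_lineRestrict, ← map_mul, h,
      Polynomial.eval_zero]
  have h2 : lineRestrict a b F ≠ 0 := fun h0 => hF fun s => by
    rw [← eval_lineRestrict, h0, Polynomial.eval_zero]
  rw [← eval_lineRestrict, (mul_eq_zero.1 h1).resolve_left h2, Polynomial.eval_zero]

/-- The line `w = f x + t * g x` with `x` fixed, in the direction `t`, lies on the surface
`F = 0`. -/
def OnSurface₁ (F : MvPolynomial (Fin 3) K) (f g : K → K) (x : K) : Prop :=
  ∀ t, eval ![f x + t * g x, t, x] F = 0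

/-- The line `w = f t + x * g t` with `t` fixed, in the direction `x`, lies on the surface
`F = 0`. -/
def OnSurface₂ (F : MvPolynomial (Fin 3) K) (f g : K → K) (t : K) : Prop :=
  ∀ x, eval ![f t + x * g t, t, x] F = 0

lemma line₁_eq (f g : K → K) (x t : K) :
    ![f x + t * g x, t, x] = fun i => ![f x, 0, x] i + ![g x, 1, 0] i * t := by
  funext i; fin_cases i <;> simp [mul_comm]

lemma line₂_eq (f g : K → K) (t x : K) :
    ![f t + x * g t, t, x] = fun i => ![f t, t, 0] i + ![g t, 0, 1] i * x := by
  funext i; fin_cases i <;> simp [mul_comm]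

lemma OnSurface₁.of_mul [Infinite K] {F G : MvPolynomial (Fin 3) K} {f g : K → K} {x : K}
    (h : OnSurface₁ (F * G) f g x) (hF : ¬ OnSurface₁ F f g x) : OnSurface₁ G f g x := by
  unfold OnSurface₁ at *
  simp only [line₁_eq] at *
  exact eval_line_mul_eq_zero _ _ F G h hF

lemma OnSurface₂.of_mul [Infinite K] {F G : MvPolynomial (Fin 3) K} {f g : K → K} {x : K}
    (h : OnSurface₂ (F * G) f g x) (hF : ¬ OnSurface₂ F f g x) : OnSurface₂ G f g x := by
  unfold OnSurface₂ at *
  simp only [line₂_eq] at *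
  exact eval_line_mul_eq_zero _ _ F G h hF

lemma onSurface₁_of_card {F : MvPolynomial (Fin 3) K} {f g : K → K} {x : K} (S : Finset K)
    (hS : F.totalDegree < S.card) (h : ∀ t ∈ S, eval ![f x + t * g x, t, x] F = 0) :
    OnSurface₁ F f g x := by
  unfold OnSurface₁
  simp only [line₁_eq] at *
  exact eval_line_eq_zero_of_card _ _ F S hS h

lemma onSurface₂_of_card {F : MvPolynomial (Fin 3) K} {f g : K → K} {t : K} (S : Finset K)
    (hS : F.totalDegree < S.card) (h : ∀ x ∈ S, eval ![f t + x * g t, t, x] F = 0) :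
    OnSurface₂ F f g t := by
  unfold OnSurface₂
  simp only [line₂_eq] at *
  exact eval_line_eq_zero_of_card _ _ F S hS h

lemma OnSurface₁.inflection [Infinite K] {F : MvPolynomial (Fin 3) K} {f g : K → K} {x : K}
    (h : OnSurface₁ F f g x) : OnSurface₁ (inflection 1 F) f g x := by
  intro t
  have hv : ∀ s : K, (fun j : Fin 3 => ![f x, 0, x] j +
      (if j = 0 then g x else if j = 1 then 1 else 0) * s) = ![f x + s * g x, s, x] := by
    intro s
    funext j
    fin_cases j <;> simp [mul_comm]
  have := eval_inflection_eq_zero (i := 1) (by decide) F ![f x, 0, x] (g x)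
    (fun s => by rw [hv]; exact h s) t
  rwa [hv] at this

/-- Incidence relation between the lines `w = Z x + t * Y x` and `w = γ t + x * α t`. -/
def Meets (Z Y γ α : K → K) (x t : K) : Prop := Z x + t * Y x = γ t + x * α t

open scoped Classical in
lemma card_meets_le_of_onSurface₁ {F : MvPolynomial (Fin 3) K} {Z Y γ α : K → K} {X : Finset K}
    {t : K} (hX : ∀ x ∈ X, OnSurface₁ F Z Y x) (ht : ¬ OnSurface₂ F γ α t) :
    (X.filter fun x => Meets Z Y γ α x t).card ≤ F.totalDegree := by
  by_contra! hlt
  refine ht (onSurface₂_of_card _ hlt fun x hx => ?_)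
  rw [Finset.mem_filter] at hx
  rw [← hx.2]
  exact hX x hx.1 t

open scoped Classical in
lemma card_meets_le_of_onSurface₂ {F : MvPolynomial (Fin 3) K} {Z Y γ α : K → K} {T : Finset K}
    {x : K} (hT : ∀ t ∈ T, OnSurface₂ F γ α t) (hx : ¬ OnSurface₁ F Z Y x) :
    (T.filter fun t => Meets Z Y γ α x t).card ≤ F.totalDegree := by
  by_contra! hlt
  refine hx (onSurface₁_of_card _ hlt fun t ht => ?_)
  rw [Finset.mem_filter] at ht
  rw [ht.2]
  exact hT t ht.1 x

lemma component_bound_arith {s k g f x₁ x₂ t₁ t₂ t₃ a b c d e : ℝ} (hs : 0 ≤ s) (hk : 0 ≤ k)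
    (hg : 0 ≤ g) (hf : 0 ≤ f) (hx₁ : 0 ≤ x₁) (hx₂ : 0 ≤ x₂) (ht₁ : 0 ≤ t₁) (ht₂ : 0 ≤ t₂)
    (ht₃ : t₃ ≤ t₁) (ha : a ≤ s * (x₁ + 16 * g ^ 2) + k * (x₁ + t₃)) (hb : b ≤ 3 * g * t₁)
    (hc : c ≤ g * t₂) (hd : d ≤ g * x₂)
    (he : e ≤ s * (x₂ + 16 * f ^ 2) + (4 * f + k) * (x₂ + t₂)) :
    a + b + c + (d + e) ≤
      s * (x₁ + x₂ + 16 * (g + f) ^ 2) + (4 * (g + f) + k) * (x₁ + x₂ + (t₁ + t₂)) := by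
  have h1 := mul_le_mul_of_nonneg_left ht₃ hk
  have h2 : 0 ≤ s * (g * f) := by positivity
  have h3 : 0 ≤ f * (x₁ + t₁) := by positivity
  have h4 : 0 ≤ g * x₁ := by positivity
  have h5 : 0 ≤ g * x₂ := by positivity
  have h6 : 0 ≤ g * t₁ := by positivity
  have h7 : 0 ≤ g * t₂ := by positivity
  linarith

open scoped Classical in
/-- Incidences between lines on a surface, in terms of incidences in small subconfigurations. -/
lemma numInc_le_of_onSurface [Infinite K] (p : ℕ) [Fact p.Prime] [CharP K p] (Z Y γ α : K → K)
    (X₀ T₀ : Finset K) (k s : ℝ) (hs : 0 ≤ s) (d₀ : ℕ) (hd₀ : d₀ < p)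
    (hk : ∀ A B C D : K, ((X₀.filter fun x => Y x = B + D * x ∧ Z x = A + C * x).card : ℝ) ≤ k)
    (hbad : ∀ X ⊆ X₀, ∀ T ⊆ T₀, T.card ≤ 16 * d₀ ^ 2 →
      (numInc (Meets Z Y γ α) X T : ℝ) ≤ (s + k) * (X.card + T.card))
    (F : MvPolynomial (Fin 3) K) (hF : F ≠ 0) (hdeg : F.totalDegree ≤ d₀) :
    ∀ X ⊆ X₀, ∀ T ⊆ T₀, (∀ x ∈ X, OnSurface₁ F Z Y x) → (∀ t ∈ T, OnSurface₂ F γ α t) →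
      (numInc (Meets Z Y γ α) X T : ℝ) ≤
        s * (X.card + 16 * F.totalDegree ^ 2) + (4 * F.totalDegree + k) * (X.card + T.card) := by
  have hk0 : 0 ≤ k := le_trans (Nat.cast_nonneg _) (hk 0 0 0 0)
  revert hF hdeg
  induction F using WfDvdMonoid.induction_on_irreducible with
  | zero => intro h; exact absurd rfl h
  | unit u hu =>
    intro _ _ X _ T _ hX _
    have : X = ∅ := by
      rw [Finset.eq_empty_iff_forall_notMem]
      intro x hx
      exact (hu.map (eval ![Z x + 0 * Y x, 0, x])).ne_zero (hX x hx 0)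
    subst this
    have h0 : numInc (Meets Z Y γ α) ∅ T = 0 := by simp [numInc]
    rw [h0]
    push_cast
    positivity
  | mul F G hF0 hG ih =>
    intro _ hdeg X hX T hT hXF hTF
    have hd := totalDegree_mul_of_isDomain hG.ne_zero hF0
    rw [hd] at hdeg ⊢
    set X₁ := X.filter fun x => OnSurface₁ G Z Y x with hX₁
    set X₂ := X.filter fun x => ¬ OnSurface₁ G Z Y x with hX₂
    set T₁ := T.filter fun t => OnSurface₂ G γ α t with hT₁
    set T₂ := T.filter fun t => ¬ OnSurface₂ G γ α t with hT₂
    have hXc : (X₁.card : ℝ) + X₂.card = X.card := by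
      exact_mod_cast Finset.card_filter_add_card_filter_not (s := X) _
    have hTc : (T₁.card : ℝ) + T₂.card = T.card := by
      exact_mod_cast Finset.card_filter_add_card_filter_not (s := T) _
    have hX₁G : ∀ x ∈ X₁, OnSurface₁ G Z Y x := fun x hx => (Finset.mem_filter.1 hx).2
    have hT₁G : ∀ t ∈ T₁, OnSurface₂ G γ α t := fun x hx => (Finset.mem_filter.1 hx).2
    have h22 := ih hF0 (by omega) X₂ ((Finset.filter_subset _ _).trans hX) T₂
      ((Finset.filter_subset _ _).trans hT)
      (fun x hx => (hXF x (Finset.mem_filter.1 hx).1).of_mul (Finset.mem_filter.1 hx).2)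
      (fun t ht => (hTF t (Finset.mem_filter.1 ht).1).of_mul (Finset.mem_filter.1 ht).2)
    have h12 : numInc (Meets Z Y γ α) X₁ T₂ ≤ G.totalDegree * T₂.card :=
      numInc_le_right _ _ _ _ fun t ht =>
        card_meets_le_of_onSurface₁ hX₁G (Finset.mem_filter.1 ht).2
    have h21 : numInc (Meets Z Y γ α) X₂ T₁ ≤ G.totalDegree * X₂.card :=
      numInc_le_left _ _ _ _ fun x hx =>
        card_meets_le_of_onSurface₂ hT₁G (Finset.mem_filter.1 hx).2
    set T₃ := T₁.filter fun t => OnSurface₂ (inflection 1 G) γ α t with hT₃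
    have hT₃c : T₃.card ≤ T₁.card := Finset.card_filter_le _ _
    have hT₄c : (T₁.filter fun t => ¬ OnSurface₂ (inflection 1 G) γ α t).card ≤ T₁.card :=
      Finset.card_filter_le _ _
    have hT₃T : T₃ ⊆ T₁ := Finset.filter_subset _ _
    have h14 : numInc (Meets Z Y γ α) X₁
        (T₁.filter fun t => ¬ OnSurface₂ (inflection 1 G) γ α t)
        ≤ 3 * G.totalDegree * T₁.card :=
      (numInc_le_right _ _ _ (3 * G.totalDegree) fun t ht =>
        (card_meets_le_of_onSurface₁ (fun x hx => (hX₁G x hx).inflection)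
          (Finset.mem_filter.1 ht).2).trans (totalDegree_inflection_le 1 G)).trans
        (Nat.mul_le_mul_left _ hT₄c)
    have h13 : (numInc (Meets Z Y γ α) X₁ T₃ : ℝ) ≤
        s * (X₁.card + 16 * G.totalDegree ^ 2) + k * (X₁.card + T₃.card) := by
      by_cases hc : T₃.card ≤ 16 * G.totalDegree ^ 2
      · have h1 := hbad X₁ ((Finset.filter_subset _ _).trans hX) T₃
          (hT₃T.trans ((Finset.filter_subset _ _).trans hT))
          (hc.trans (Nat.mul_le_mul_left _ (Nat.pow_le_pow_left (by omega) 2)))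
        have h2 : (T₃.card : ℝ) ≤ 16 * G.totalDegree ^ 2 := by exact_mod_cast hc
        have h3 := mul_le_mul_of_nonneg_left h2 hs
        linarith
      · obtain ⟨A, B, E, D, h⟩ := exists_regulus p G hG (by omega) Z Y α γ X₁ T₃ (not_le.1 hc)
          (fun t ht => hT₁G t (hT₃T ht)) (fun t ht => (Finset.mem_filter.1 ht).2) hX₁G
        have h1 : (X₁.card : ℝ) ≤ k := by
          refine le_trans ?_ (hk A B E D)
          exact_mod_cast Finset.card_le_card fun x hx =>
            Finset.mem_filter.2 ⟨hX (Finset.mem_filter.1 hx).1, h x hx⟩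
        have h2 : (numInc (Meets Z Y γ α) X₁ T₃ : ℝ) ≤ X₁.card * T₃.card := by
          exact_mod_cast numInc_le_mul _ _ _
        have h3 : (X₁.card : ℝ) * T₃.card ≤ k * T₃.card := by gcongr
        have h4 : 0 ≤ s * (X₁.card + 16 * G.totalDegree ^ 2) + k * X₁.card := by positivity
        linarith
    have hsum : numInc (Meets Z Y γ α) X T = (numInc (Meets Z Y γ α) X₁ T₃ +
        numInc (Meets Z Y γ α) X₁ (T₁.filter fun t => ¬ OnSurface₂ (inflection 1 G) γ α t)) +
        numInc (Meets Z Y γ α) X₁ T₂ +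
        (numInc (Meets Z Y γ α) X₂ T₁ + numInc (Meets Z Y γ α) X₂ T₂) := by
      rw [← numInc_split_right, ← numInc_split_right, ← numInc_split_right, ← numInc_split_left]
    have h12' : (numInc (Meets Z Y γ α) X₁ T₂ : ℝ) ≤ G.totalDegree * T₂.card := by
      exact_mod_cast h12
    have h21' : (numInc (Meets Z Y γ α) X₂ T₁ : ℝ) ≤ G.totalDegree * X₂.card := by
      exact_mod_cast h21
    have h14' : (numInc (Meets Z Y γ α) X₁
        (T₁.filter fun t => ¬ OnSurface₂ (inflection 1 G) γ α t) : ℝ)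
        ≤ 3 * G.totalDegree * T₁.card := by exact_mod_cast h14
    have hT₃c' : (T₃.card : ℝ) ≤ T₁.card := by exact_mod_cast hT₃c
    rw [← hXc, ← hTc, hsum]
    simp only [Nat.cast_add]
    exact component_bound_arith hs hk0 (Nat.cast_nonneg _) (Nat.cast_nonneg _)
      (Nat.cast_nonneg _) (Nat.cast_nonneg _) (Nat.cast_nonneg _) (Nat.cast_nonneg _)
      hT₃c' h13 h14' h12' h21' h22

end Components

section MainBound

variable {K : Type*} [Field K]

lemma exists_surface [Infinite K] (Z Y : K → K) (X : Finset K) (D : ℕ)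
    (hD : 3 * X.card < D ^ 2) :
    ∃ F : MvPolynomial (Fin 3) K, F ≠ 0 ∧ F.totalDegree < 3 * D ∧
      ∀ x ∈ X, OnSurface₁ F Z Y x := by
  classical
  have hD0 : 0 < D := by
    rcases Nat.eq_zero_or_pos D with rfl | h
    · simp at hD
    · exact h
  obtain ⟨S, hS⟩ := Infinite.exists_subset_card_eq K (3 * D)
  obtain ⟨F, hF, hdeg, hv⟩ := exists_vanishing_polynomial
    ((X ×ˢ S).image fun q => ![Z q.1 + q.2 * Y q.1, q.2, q.1]) D (by
      refine Finset.card_image_le.trans_lt ?_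
      rw [Finset.card_product, hS]
      calc X.card * (3 * D) = D * (3 * X.card) := by ring
        _ < D * D ^ 2 := by gcongr
        _ = D ^ 3 := by ring)
  refine ⟨F, hF, hdeg, fun x hx => onSurface₁_of_card S (by omega) fun t ht => ?_⟩
  exact hv _ (Finset.mem_image.2 ⟨(x, t), Finset.mem_product.2 ⟨hx, ht⟩, rfl⟩)

lemma numInc_meets_comm (Z Y γ α : K → K) (X T : Finset K) :
    numInc (Meets Z Y γ α) X T = numInc (Meets γ α Z Y) T X := by
  rw [← numInc_flip]
  congr 1
  funext t x
  exact propext eq_comm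

lemma sqrt_le_mul_sqrt {w c n : ℝ} (hc : 0 ≤ c) (h : w ≤ c ^ 2 * n) : √w ≤ c * √n := by
  rw [← Real.sqrt_sq hc, ← Real.sqrt_mul (sq_nonneg c)]
  exact Real.sqrt_le_sqrt h

lemma mul_sqrt_le_mul_sqrt {u v : ℝ} (hv : 0 ≤ v) (h : u ≤ v) : u * √u ≤ v * √v :=
  mul_le_mul h (Real.sqrt_le_sqrt h) (Real.sqrt_nonneg _) hv

/-- A recursion inequality for `n ↦ n * √n`. -/
lemma recursion_arith {n m f a u : ℝ} (hn : 0 < n) (hm : 10 ^ 12 ≤ m) (hf : n / (2 * m) ≤ f)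
    (hf' : f ≤ n / 2) (ha : a ≤ n - f) (hu : u ≤ f + 1296 * (n / m)) :
    a * √a + u * √u + 1 / (10 * m) * (n * √n) ≤ n * √n := by
  have hm0 : 0 < m := by linarith
  set δ := n / m with hδ
  have hδ0 : 0 < δ := by positivity
  have hf2 : δ / 2 ≤ f := by
    rw [hδ, div_div, mul_comm m]; exact hf
  have hδn : δ * 10 ^ 12 ≤ n := by
    rw [hδ, div_mul_eq_mul_div, div_le_iff₀ hm0]
    gcongr
  have hsn := Real.sqrt_nonneg n
  have h1 : a * √a ≤ (n - f) * √n := by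
    refine (mul_sqrt_le_mul_sqrt (by linarith) ha).trans ?_
    refine mul_le_mul_of_nonneg_left (Real.sqrt_le_sqrt (by linarith)) (by linarith)
  have h2 : u * √u ≤ 4 / 5 * f * √n := by
    refine (mul_sqrt_le_mul_sqrt (by linarith) hu).trans ?_
    rcases le_total (20 * (1296 * δ)) f with h | h
    · have e1 : f + 1296 * δ ≤ 21 / 20 * f := by linarith
      have e2 : √(f + 1296 * δ) ≤ 73 / 100 * √n :=
        sqrt_le_mul_sqrt (by norm_num) (by linarith)
      calc (f + 1296 * δ) * √(f + 1296 * δ) ≤ (21 / 20 * f) * (73 / 100 * √n) :=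
            mul_le_mul e1 e2 (Real.sqrt_nonneg _) (by linarith)
        _ = 1533 / 2000 * (f * √n) := by ring
        _ ≤ 4 / 5 * (f * √n) :=
            mul_le_mul_of_nonneg_right (by norm_num) (mul_nonneg (by linarith) hsn)
        _ = _ := by ring
    · have e1 : f + 1296 * δ ≤ 2593 * f := by linarith
      have e2 : √(f + 1296 * δ) ≤ 1 / 5000 * √n :=
        sqrt_le_mul_sqrt (by norm_num) (by linarith)
      calc (f + 1296 * δ) * √(f + 1296 * δ) ≤ (2593 * f) * (1 / 5000 * √n) :=
            mul_le_mul e1 e2 (Real.sqrt_nonneg _) (by linarith)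
        _ = 2593 / 5000 * (f * √n) := by ring
        _ ≤ 4 / 5 * (f * √n) :=
            mul_le_mul_of_nonneg_right (by norm_num) (mul_nonneg (by linarith) hsn)
        _ = _ := by ring
  have h3 : 1 / (10 * m) * (n * √n) ≤ 1 / 5 * f * √n := by
    have e : 1 / (10 * m) * (n * √n) = (δ / 10) * √n := by rw [hδ]; field_simp
    rw [e]
    exact mul_le_mul_of_nonneg_right (by linarith) hsn
  nlinarith

open scoped Classical in
lemma numInc_le_of_surface (F : MvPolynomial (Fin 3) K) (Z Y γ α : K → K) (X T : Finset K) :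
    numInc (Meets Z Y γ α) X T ≤ F.totalDegree * (X.card + T.card) +
      numInc (Meets Z Y γ α) (X.filter (OnSurface₁ F Z Y)) (T.filter (OnSurface₂ F γ α)) +
      numInc (Meets Z Y γ α) (X.filter fun x => ¬ OnSurface₁ F Z Y x)
        (T.filter fun t => ¬ OnSurface₂ F γ α t) := by
  have h12 : numInc (Meets Z Y γ α) (X.filter (OnSurface₁ F Z Y))
      (T.filter fun t => ¬ OnSurface₂ F γ α t) ≤ F.totalDegree * T.card :=
    (numInc_le_right _ _ _ F.totalDegree fun t ht =>
      card_meets_le_of_onSurface₁ (fun x hx => (Finset.mem_filter.1 hx).2)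
        (Finset.mem_filter.1 ht).2).trans (Nat.mul_le_mul_left _ (Finset.card_filter_le _ _))
  have h21 : numInc (Meets Z Y γ α) (X.filter fun x => ¬ OnSurface₁ F Z Y x)
      (T.filter (OnSurface₂ F γ α)) ≤ F.totalDegree * X.card :=
    (numInc_le_left _ _ _ F.totalDegree fun x hx =>
      card_meets_le_of_onSurface₂ (fun t ht => (Finset.mem_filter.1 ht).2)
        (Finset.mem_filter.1 hx).2).trans (Nat.mul_le_mul_left _ (Finset.card_filter_le _ _))
  rw [numInc_split_left _ X T (OnSurface₁ F Z Y),
    numInc_split_right _ (X.filter (OnSurface₁ F Z Y)) T (OnSurface₂ F γ α),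
    numInc_split_right _ (X.filter fun x => ¬ OnSurface₁ F Z Y x) T (OnSurface₂ F γ α)]
  linarith

lemma card_filter_le_of_subset {ι : Type*} {k : ℝ} {X X' : Finset ι} (h : X' ⊆ X) (P : ι → Prop)
    [DecidablePred P] (hk : ((X.filter P).card : ℝ) ≤ k) : ((X'.filter P).card : ℝ) ≤ k :=
  le_trans (by exact_mod_cast Finset.card_le_card (Finset.filter_subset_filter P h)) hk

open scoped Classical in
/-- The incidence bound for the pairs of lines lying in the planes `x = const` and `t = const`. -/
theorem numInc_meets_le [Infinite K] (p : ℕ) [Fact p.Prime] [CharP K p] (m : ℕ)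
    (hm : 10 ^ 12 ≤ m) (k : ℝ) (N : ℕ) :
    ∀ (Z Y γ α : K → K) (X T : Finset K), X.card + T.card = N → 81 * N < m * p ^ 2 →
      (∀ A B C D : K, ((X.filter fun x => Y x = B + D * x ∧ Z x = A + C * x).card : ℝ) ≤ k) →
      (∀ A B C D : K, ((T.filter fun t => α t = B + D * t ∧ γ t = A + C * t).card : ℝ) ≤ k) →
      (numInc (Meets Z Y γ α) X T : ℝ) ≤ 450 * m * (N * √N) + k * N := by
  induction N using Nat.strong_induction_on with
  | _ N ih =>
  intro Z Y γ α X T hN hp hkX hkT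
  have hk0 : 0 ≤ k := le_trans (Nat.cast_nonneg _) (hkX 0 0 0 0)
  have hm' : (10 : ℝ) ^ 12 ≤ m := by exact_mod_cast hm
  wlog hle : X.card ≤ T.card generalizing Z Y γ α X T with H
  · rw [numInc_meets_comm]
    exact H γ α Z Y T X (by omega) hkT hkX (by omega)
  rcases lt_or_ge N m with hNm | hNm
  · have h1 : (numInc (Meets Z Y γ α) X T : ℝ) ≤ N * N := by
      have := (numInc_le_mul (Meets Z Y γ α) X T).trans
        (Nat.mul_le_mul (by omega : X.card ≤ N) (by omega : T.card ≤ N))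
      exact_mod_cast this
    have h2 : (N : ℝ) ≤ m * √N := by
      have e1 : √(N : ℝ) ≤ m := by
        rw [Real.sqrt_le_left (by positivity)]
        have : (N : ℝ) ≤ m := by exact_mod_cast hNm.le
        nlinarith
      nlinarith [Real.mul_self_sqrt (Nat.cast_nonneg (α := ℝ) N), Real.sqrt_nonneg (N : ℝ)]
    have h3 : (0 : ℝ) ≤ N := Nat.cast_nonneg N
    have h4 : (N : ℝ) * N ≤ N * (m * √N) := mul_le_mul_of_nonneg_left h2 h3
    have h5 : 0 ≤ k * N := by positivity
    have h6 : (0 : ℝ) ≤ m * (N * √N) := by positivity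
    nlinarith
  have hm0 : 0 < m := by omega
  have hm0' : (0 : ℝ) < m := by exact_mod_cast hm0
  have hn1 : (m : ℝ) ≤ N := by exact_mod_cast hNm
  have hn0 : (0 : ℝ) < N := by linarith
  set n : ℝ := (N : ℝ) with hn
  have hδ1 : 1 ≤ n / m := (one_le_div hm0').2 hn1
  obtain ⟨X₁, hX₁, hX₁c⟩ := Finset.exists_subset_card_eq (min_le_left X.card (N / m))
  have hX₁n : (X₁.card : ℝ) ≤ n / m := by
    refine le_trans ?_ Nat.cast_div_le
    rw [hX₁c]
    exact_mod_cast min_le_right _ _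
  obtain ⟨F, hF, hdeg, hFX⟩ := exists_surface Z Y X₁ (Nat.sqrt (3 * X₁.card) + 1)
    (by rw [sq]; exact Nat.lt_succ_sqrt _)
  set d := F.totalDegree with hd
  have hσ : √(n / m) ^ 2 = n / m := Real.sq_sqrt (by positivity)
  have hσ1 : 1 ≤ √(n / m) := Real.one_le_sqrt.2 hδ1
  have hdσ : (d : ℝ) ≤ 9 * √(n / m) := by
    have h1 : (Nat.sqrt (3 * X₁.card) : ℝ) ≤ 2 * √(n / m) := by
      refine (Real.nat_sqrt_le_real_sqrt).trans (sqrt_le_mul_sqrt (by norm_num) ?_)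
      push_cast
      linarith
    have h2 : (d : ℝ) ≤ 3 * ((Nat.sqrt (3 * X₁.card) : ℝ) + 1) := by exact_mod_cast hdeg.le
    linarith
  have hd2 : (d : ℝ) ^ 2 ≤ 81 * (n / m) := by
    rw [← hσ]
    nlinarith [Nat.cast_nonneg (α := ℝ) d]
  have hdp : d < p := by
    have h1 : 81 * (n / m) < (p : ℝ) ^ 2 := by
      rw [← mul_div_assoc, div_lt_iff₀ hm0', mul_comm ((p : ℝ) ^ 2)]
      rw [hn]
      exact_mod_cast hp
    have h2 : (d : ℝ) < p := lt_of_pow_lt_pow_left₀ 2 (Nat.cast_nonneg _) (hd2.trans_lt h1)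
    exact_mod_cast h2
  set XF := X.filter (OnSurface₁ F Z Y) with hXF
  set TF := T.filter (OnSurface₂ F γ α) with hTF
  have hXFX : XF ⊆ X := Finset.filter_subset _ _
  have hTFT : TF ⊆ T := Finset.filter_subset _ _
  have hXFc : (XF.card : ℝ) ≤ n / 2 := by
    have h1 := Finset.card_le_card hXFX
    have h2 : 2 * XF.card ≤ N := by omega
    have h3 : (2 : ℝ) * XF.card ≤ n := by rw [hn]; exact_mod_cast h2
    linarith
  have hδn : n / m * 10 ^ 12 ≤ n := by
    rw [div_mul_eq_mul_div, div_le_iff₀ hm0']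
    gcongr
  set u : ℝ := XF.card + 16 * (d : ℝ) ^ 2 with hu
  have hu0 : 0 ≤ u := by positivity
  have hu' : u ≤ XF.card + 1296 * (n / m) := by linarith
  have hun : u < n := by linarith
  have hsub : ∀ X' ⊆ X, ∀ T' ⊆ T, X'.card + T'.card < N →
      (numInc (Meets Z Y γ α) X' T' : ℝ) ≤ 450 * m * ((X'.card + T'.card) *
        √((X'.card : ℝ) + T'.card)) + k * (X'.card + T'.card) := by
    intro X' hX' T' hT' hlt
    have := ih _ hlt Z Y γ α X' T' rfl
      (lt_of_le_of_lt (Nat.mul_le_mul_left _ hlt.le) hp)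
      (fun A B C D => card_filter_le_of_subset hX' _ (hkX A B C D))
      (fun A B C D => card_filter_le_of_subset hT' _ (hkT A B C D))
    exact_mod_cast this
  have hin : (numInc (Meets Z Y γ α) XF TF : ℝ) ≤
      450 * m * (u * √u) + (4 * d + k) * (XF.card + TF.card) := by
    have := numInc_le_of_onSurface p Z Y γ α XF TF k (450 * m * √u) (by positivity) d hdp
      (fun A B C D => card_filter_le_of_subset hXFX _ (hkX A B C D)) (by
        intro X' hX' T' hT' hTc
        have h1 : (X'.card : ℝ) + T'.card ≤ u := by
          have h2 : (X'.card : ℝ) ≤ XF.card := by exact_mod_cast Finset.card_le_card hX'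
          have h3 : (T'.card : ℝ) ≤ 16 * (d : ℝ) ^ 2 := by exact_mod_cast hTc
          linarith
        have h4 : X'.card + T'.card < N := by
          have : ((X'.card + T'.card : ℕ) : ℝ) < N := by
            push_cast
            linarith
          exact_mod_cast this
        refine (hsub X' (hX'.trans hXFX) T' (hT'.trans hTFT) h4).trans ?_
        have h5 := Real.sqrt_le_sqrt h1
        have h6 : (0 : ℝ) ≤ (X'.card : ℝ) + T'.card := by positivity
        calc _ ≤ 450 * m * (((X'.card : ℝ) + T'.card) * √u) + k * (X'.card + T'.card) := by
              gcongr
          _ = _ := by ring)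
      F hF le_rfl XF subset_rfl TF subset_rfl (fun x hx => (Finset.mem_filter.1 hx).2)
      (fun t ht => (Finset.mem_filter.1 ht).2)
    refine this.trans (le_of_eq ?_)
    rw [hu]
    ring
  have hcount := numInc_le_of_surface F Z Y γ α X T
  rw [hN, ← hd] at hcount
  have hcount' : (numInc (Meets Z Y γ α) X T : ℝ) ≤ d * n + numInc (Meets Z Y γ α) XF TF +
      numInc (Meets Z Y γ α) (X.filter fun x => ¬ OnSurface₁ F Z Y x)
        (T.filter fun t => ¬ OnSurface₂ F γ α t) := by rw [hn]; exact_mod_cast hcount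
  set XR := X.filter fun x => ¬ OnSurface₁ F Z Y x with hXR
  set TR := T.filter fun t => ¬ OnSurface₂ F γ α t with hTR
  have hXc : XF.card + XR.card = X.card := Finset.card_filter_add_card_filter_not _
  have hTc : TF.card + TR.card = T.card := Finset.card_filter_add_card_filter_not _
  have hsumc : ((XF.card : ℝ) + TF.card) + (XR.card + TR.card) = n := by
    have : (XF.card + TF.card) + (XR.card + TR.card) = N := by omega
    rw [hn]
    exact_mod_cast this
  have hdn : 5 * d * n ≤ 450 * m * (1 / (10 * m) * (n * √n)) := by
    have h1 : √(n / m) ≤ √n := Real.sqrt_le_sqrt (div_le_self hn0.le (by linarith))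
    have h2 : (d : ℝ) * n ≤ (9 * √n) * n := by gcongr; linarith
    have h3 : 450 * m * (1 / (10 * m) * (n * √n)) = 5 * ((9 * √n) * n) := by
      field_simp
      ring
    linarith
  have hin2 : (4 * d + k) * ((XF.card : ℝ) + TF.card) ≤
      4 * d * n + k * (XF.card + TF.card) := by
    have h1 : (XF.card : ℝ) + TF.card ≤ n := by
      have : (0 : ℝ) ≤ XR.card + TR.card :=
        add_nonneg (Nat.cast_nonneg _) (Nat.cast_nonneg _)
      linarith
    have h2 := mul_le_mul_of_nonneg_left h1 (by positivity : (0 : ℝ) ≤ 4 * d)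
    linarith
  have hX₁F : X₁ ⊆ XF := fun x hx => Finset.mem_filter.2 ⟨hX₁ hx, hFX x hx⟩
  rcases le_total X.card (N / m) with hA | hB
  · have hX₁X : X₁ = X := Finset.eq_of_subset_of_card_le hX₁ (by rw [hX₁c, min_eq_left hA])
    have hXR0 : XR = ∅ := by
      rw [Finset.filter_eq_empty_iff]
      intro x hx
      rw [not_not]
      exact hFX x (hX₁X ▸ hx)
    have h0 : numInc (Meets Z Y γ α) XR TR = 0 := by
      rw [hXR0]
      simp [numInc]
    rw [h0] at hcount'
    have hXFn : (XF.card : ℝ) ≤ n / m := by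
      refine le_trans ?_ hX₁n
      rw [hX₁X]
      exact_mod_cast Finset.card_le_card hXFX
    have h1 : u * √u ≤ 1 / 2 * (n * √n) := by
      have h2 : √u ≤ √n := Real.sqrt_le_sqrt hun.le
      calc u * √u ≤ (1 / 2 * n) * √n :=
            mul_le_mul (by linarith) h2 (Real.sqrt_nonneg _) (by positivity)
        _ = _ := by ring
    have h3 : 1 / (10 * (m : ℝ)) * (n * √n) ≤ 1 / 2 * (n * √n) := by
      gcongr
      linarith
    have h4 : 450 * m * (u * √u + 1 / (10 * m) * (n * √n)) ≤ 450 * m * (n * √n) := by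
      gcongr
      linarith
    have h5 : k * ((XF.card : ℝ) + TF.card) ≤ k * n := by
      refine mul_le_mul_of_nonneg_left ?_ hk0
      have : (0 : ℝ) ≤ XR.card + TR.card :=
        add_nonneg (Nat.cast_nonneg _) (Nat.cast_nonneg _)
      linarith
    push_cast at hcount'
    linarith
  · have hX₁c' : X₁.card = N / m := by rw [hX₁c, min_eq_right hB]
    have hq1 : 1 ≤ N / m := (Nat.one_le_div_iff hm0).2 hNm
    have hXF1 : N / m ≤ XF.card := hX₁c' ▸ Finset.card_le_card hX₁F
    have hf : n / (2 * m) ≤ XF.card := by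
      have h1 : N ≤ 2 * m * XF.card := by
        have h2 := Nat.lt_mul_div_succ N hm0
        have h3 : m * (N / m + 1) ≤ m * (2 * XF.card) := Nat.mul_le_mul_left _ (by omega)
        linarith
      rw [div_le_iff₀ (by positivity), mul_comm, hn]
      exact_mod_cast h1
    have hR := hsub XR (Finset.filter_subset _ _) TR (Finset.filter_subset _ _) (by omega)
    have h1 := recursion_arith hn0 hm' hf hXFc
      (a := (XR.card : ℝ) + TR.card) (by
        have : (0 : ℝ) ≤ TF.card := Nat.cast_nonneg _
        linarith) hu'
    have h2 := mul_le_mul_of_nonneg_left h1 (by positivity : (0 : ℝ) ≤ 450 * m)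
    have h3 : k * n = k * (XF.card + TF.card) + k * (XR.card + TR.card) := by
      rw [← hsumc]; ring
    linarith

end MainBound

section Symplectic

/-- There is an infinite field extension with an element of degree at least four. -/
lemma exists_infinite_extension (k : Type) [Field k] : ∃ (K : Type) (_ : Field K)
    (_ : Algebra k K) (_ : Infinite K) (ε : K), ∀ a b c d : k,
      algebraMap k K a + algebraMap k K b * ε + algebraMap k K c * ε ^ 2
        + algebraMap k K d * ε ^ 3 = 0 → a = 0 ∧ b = 0 ∧ c = 0 ∧ d = 0 := by
  refine ⟨FractionRing (Polynomial k), inferInstance, inferInstance,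
    Infinite.of_injective (algebraMap (Polynomial k) (FractionRing (Polynomial k)))
      (IsFractionRing.injective _ _), algebraMap (Polynomial k) _ Polynomial.X, ?_⟩
  intro a b c d h
  simp only [IsScalarTower.algebraMap_apply k (Polynomial k) (FractionRing (Polynomial k)),
    ← map_mul, ← map_pow, ← map_add, Polynomial.algebraMap_eq] at h
  rw [map_eq_zero_iff _ (IsFractionRing.injective (Polynomial k) _)] at h
  have h' := fun n => congrArg (fun f => Polynomial.coeff f n) h
  have h0 := h' 0
  have h1 := h' 1
  have h2 := h' 2
  have h3 := h' 3
  simp [Polynomial.coeff_X, Polynomial.coeff_C] at h0 h1 h2 h3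
  exact ⟨h0, h1, h2, h3⟩

variable {k K : Type*} [Field k] [Field K] [Algebra k K]

open scoped Classical in
lemma card_filter_linear_le (ε : K) (Y C : Finset k) (h0 : (0 : k) ∉ Y) (A B E D : K) :
    ((Y ×ˢ C ×ˢ C).filter fun v : k × k × k =>
      algebraMap k K v.1 = B * (1 - ε ^ 2 * algebraMap k K (v.1 * v.2.1))
        + D * (algebraMap k K v.2.2 - ε * algebraMap k K v.1) ∧
      algebraMap k K (v.1 * v.2.1) = A * (1 - ε ^ 2 * algebraMap k K (v.1 * v.2.1))
        + E * (algebraMap k K v.2.2 - ε * algebraMap k K v.1)).card ≤ C.card + Y.card := by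
  set V := (Y ×ˢ C ×ˢ C).filter fun v : k × k × k =>
      algebraMap k K v.1 = B * (1 - ε ^ 2 * algebraMap k K (v.1 * v.2.1))
        + D * (algebraMap k K v.2.2 - ε * algebraMap k K v.1) ∧
      algebraMap k K (v.1 * v.2.1) = A * (1 - ε ^ 2 * algebraMap k K (v.1 * v.2.1))
        + E * (algebraMap k K v.2.2 - ε * algebraMap k K v.1) with hV
  have hinj := (algebraMap k K).injective
  have hmem : ∀ v ∈ V, v.1 ∈ Y ∧ v.2.1 ∈ C ∧ v.2.2 ∈ C := fun v hv => by
    have := (Finset.mem_filter.1 hv).1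
    simpa using this
  by_cases hy : Set.InjOn (fun v : k × k × k => v.1) V
  · exact (Finset.card_le_card_of_injOn _ (fun v hv => (hmem v hv).1) hy).trans
      (Nat.le_add_left _ _)
  refine le_trans ?_ (Nat.le_add_right C.card Y.card)
  simp only [Set.InjOn] at hy
  push Not at hy
  obtain ⟨⟨y, a, c⟩, hv, ⟨y', a', c'⟩, hv', hyy, hne⟩ := hy
  obtain rfl : y = y' := hyy
  have hy0 : ∀ v ∈ V, v.1 ≠ 0 := fun v hv h => h0 (h ▸ (hmem v hv).1)
  have hyne := hy0 _ hv
  have e := (Finset.mem_filter.1 hv).2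
  have e' := (Finset.mem_filter.1 hv').2
  simp only [map_mul] at e e'
  obtain ⟨e1, e2⟩ := e
  obtain ⟨e1', e2'⟩ := e'
  by_cases haa : a = a'
  · subst haa
    have hcc : algebraMap k K c - algebraMap k K c' ≠ 0 := by
      rw [sub_ne_zero]
      intro h
      exact hne (by rw [hinj h])
    have hD : D = 0 := by
      refine (mul_eq_zero.1 ?_).resolve_right hcc
      linear_combination e1' - e1
    have hE : E = 0 := by
      refine (mul_eq_zero.1 ?_).resolve_right hcc
      linear_combination e2' - e2
    subst hD hE
    refine Finset.card_le_card_of_injOn (fun v => v.2.2) (fun v hv => (hmem v hv).2.2) ?_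
    rintro ⟨y₁, a₁, c₁⟩ h₁ ⟨y₂, a₂, c₂⟩ h₂ (rfl : c₁ = c₂)
    have hy₁ := hy0 _ h₁
    obtain ⟨f1, f2⟩ := (Finset.mem_filter.1 h₁).2
    obtain ⟨g1, g2⟩ := (Finset.mem_filter.1 h₂).2
    simp only at f1 f2 g1 g2 hy₁
    have hA : 1 + A * ε ^ 2 ≠ 0 := by
      intro hA
      have : A = 0 := by linear_combination algebraMap k K (y₁ * a₁) * hA - f2
      rw [this] at hA
      simp at hA
    have hs : algebraMap k K (y₁ * a₁) = algebraMap k K (y₂ * a₂) := by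
      apply mul_left_cancel₀ hA
      linear_combination f2 - g2
    have hyy : y₁ = y₂ := by
      apply hinj
      rw [f1, g1, hs]
      ring
    subst hyy
    have haa := mul_left_cancel₀ hy₁ (hinj hs)
    rw [haa]
  · have hs : algebraMap k K y * (algebraMap k K a - algebraMap k K a') ≠ 0 := by
      refine mul_ne_zero ?_ (sub_ne_zero.2 fun h => haa (hinj h))
      exact fun h => hyne (hinj (by rw [h, map_zero]))
    set l := (algebraMap k K c - algebraMap k K c') /
      (algebraMap k K y * (algebraMap k K a - algebraMap k K a')) with hl
    have hl' : l * (algebraMap k K y * (algebraMap k K a - algebraMap k K a')) =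
      algebraMap k K c - algebraMap k K c' := div_mul_cancel₀ _ hs
    have hB : B * ε ^ 2 = D * l := by
      apply mul_right_cancel₀ hs
      linear_combination e1 - e1' - D * hl'
    have hA : 1 + A * ε ^ 2 = E * l := by
      apply mul_right_cancel₀ hs
      linear_combination e2 - e2' - E * hl'
    have hE : E ≠ 0 := by
      rintro rfl
      have hA0 : A = 0 := by linear_combination (algebraMap k K y * algebraMap k K a) * hA - e2
      rw [hA0] at hA
      simp at hA
    have key : ∀ v ∈ V, algebraMap k K v.1 = B - D * (A / E) ∧
        algebraMap k K v.2.2 = l * algebraMap k K (v.1 * v.2.1) + ε * algebraMap k K v.1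
          - A / E := by
      intro v hv
      obtain ⟨f1, f2⟩ := (Finset.mem_filter.1 hv).2
      have hw : ε * algebraMap k K v.1 + l * algebraMap k K (v.1 * v.2.1)
          - algebraMap k K v.2.2 = A / E := by
        rw [eq_div_iff hE]
        linear_combination f2 - algebraMap k K (v.1 * v.2.1) * hA
      constructor
      · rw [← hw]
        linear_combination f1 - algebraMap k K (v.1 * v.2.1) * hB
      · linear_combination -hw
    refine Finset.card_le_card_of_injOn (fun v => v.2.1) (fun v hv => (hmem v hv).2.1) ?_
    rintro ⟨y₁, a₁, c₁⟩ h₁ ⟨y₂, a₂, c₂⟩ h₂ (rfl : a₁ = a₂)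
    obtain ⟨f1, f2⟩ := key _ h₁
    obtain ⟨g1, g2⟩ := key _ h₂
    simp only at f1 f2 g1 g2
    have hyy : y₁ = y₂ := hinj (f1.trans g1.symm)
    subst hyy
    rw [hinj (f2.trans g2.symm)]

end Symplectic

section ScaledDifferences

/-- An upper bound for the number of solutions of `y (a - c') = y' (a' - c)` with `y, y' ∈ Y` and
`a, c, a', c' ∈ C`, from the incidence bound for lines in the ruled congruence. -/
lemma card_scaled_sub_eq_le (p : ℕ) [Fact p.Prime] (m : ℕ) (hm : 10 ^ 12 ≤ m)
    (Y C : Finset (ZMod p)) (h0 : (0 : ZMod p) ∉ Y)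
    (hN : 81 * (2 * (Y.card * (C.card * C.card))) < m * p ^ 2) :
    ((((Y ×ˢ C ×ˢ C) ×ˢ (Y ×ˢ C ×ˢ C)).filter fun q =>
        q.1.1 * (q.1.2.1 - q.2.2.2) = q.2.1 * (q.2.2.1 - q.1.2.2)).card : ℝ)
      ≤ 450 * m * ((2 * (Y.card * (C.card * C.card)) : ℕ)
          * √(2 * (Y.card * (C.card * C.card)) : ℕ))
        + (C.card + Y.card : ℕ) * (2 * (Y.card * (C.card * C.card)) : ℕ) := by
  classical
  obtain ⟨K, _, _, _, ε, hε⟩ := exists_infinite_extension (ZMod p)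
  have hinj := (algebraMap (ZMod p) K).injective
  have : CharP K p := charP_of_injective_algebraMap hinj p
  set V : Finset (ZMod p × ZMod p × ZMod p) := Y ×ˢ C ×ˢ C with hV
  let S : ZMod p × ZMod p × ZMod p → K := fun v => 1 - ε ^ 2 * algebraMap (ZMod p) K (v.1 * v.2.1)
  let R : ZMod p × ZMod p × ZMod p → K := fun v =>
    algebraMap (ZMod p) K v.2.2 - ε * algebraMap (ZMod p) K v.1
  have hS : ∀ v, S v ≠ 0 := by
    intro v hv
    refine one_ne_zero (hε 1 0 (-(v.1 * v.2.1)) 0 ?_).1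
    simp only [S] at hv
    simp only [map_one, map_zero, map_neg]
    linear_combination hv
  let x : ZMod p × ZMod p × ZMod p → K := fun v => R v / S v
  have hx : Set.InjOn x V := by
    rintro ⟨y, a, c⟩ hv ⟨y', a', c'⟩ hv' h
    have hy : y ≠ 0 := fun h => h0 (h ▸ (Finset.mem_product.1 hv).1)
    simp only [x] at h
    rw [div_eq_div_iff (hS _) (hS _)] at h
    simp only [R, S, map_mul] at h
    obtain ⟨e0, e1, -, e3⟩ := hε (c - c') (y' - y) (c' * (y * a) - c * (y' * a'))
      (y * (y' * a') - y' * (y * a)) (by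
        simp only [map_mul, map_sub]
        linear_combination h)
    obtain rfl := sub_eq_zero.1 e0
    obtain rfl := sub_eq_zero.1 e1
    have e4 : y' * y' * (a' - a) = 0 := by linear_combination e3
    obtain rfl := sub_eq_zero.1 ((mul_eq_zero.1 e4).resolve_left (mul_ne_zero hy hy))
    rfl
  let g := Function.invFunOn x V
  have hg : ∀ v ∈ V, g (x v) = v := fun v hv => hx.leftInvOn_invFunOn hv
  let Z : K → K := fun s => algebraMap (ZMod p) K ((g s).1 * (g s).2.1) / S (g s)
  let W : K → K := fun s => algebraMap (ZMod p) K (g s).1 / S (g s)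
  have hZ : ∀ v ∈ V, Z (x v) = algebraMap (ZMod p) K (v.1 * v.2.1) / S v := fun v hv => by
    simp only [Z, hg v hv]
  have hW : ∀ v ∈ V, W (x v) = algebraMap (ZMod p) K v.1 / S v := fun v hv => by
    simp only [W, hg v hv]
  have hcardV : V.card = Y.card * (C.card * C.card) := by simp [hV, Finset.card_product]
  have hX : (V.image x).card = V.card := Finset.card_image_of_injOn hx
  have hx' : Set.InjOn (fun v => -x v) V := fun u hu v hv h => hx hu hv (neg_injective h)
  have hT : (V.image fun v => -x v).card = V.card := Finset.card_image_of_injOn hx'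
  have key := numInc_meets_le (K := K) p m hm (C.card + Y.card : ℕ)
    (2 * (Y.card * (C.card * C.card))) Z W (fun t => Z (-t)) (fun t => -W (-t))
    (V.image x) (V.image fun v => -x v) (by rw [hX, hT, hcardV]; ring) hN ?_ ?_
  · refine le_trans ?_ key
    rw [Nat.cast_le, numInc]
    refine Finset.card_le_card_of_injOn (fun q => (x q.1, -x q.2)) ?_ ?_
    · rintro ⟨v, u⟩ hq
      obtain ⟨hq, he⟩ := Finset.mem_filter.1 hq
      obtain ⟨hv, hu⟩ := Finset.mem_product.1 hq
      refine Finset.mem_filter.2 ⟨Finset.mem_product.2 ⟨Finset.mem_image_of_mem _ hv,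
        Finset.mem_image_of_mem (fun v => -x v) hu⟩, ?_⟩
      simp only [Meets, neg_neg, hZ v hv, hZ u hu, hW v hv, hW u hu, x]
      have h1 := hS v
      have h2 := hS u
      field_simp
      have he' := congrArg (algebraMap (ZMod p) K) he
      simp only [map_mul, map_sub] at he'
      simp only [R, S, map_mul]
      linear_combination he'
    · rintro ⟨v, u⟩ hq ⟨v', u'⟩ hq' h
      obtain ⟨hv, hu⟩ := Finset.mem_product.1 (Finset.mem_filter.1 hq).1
      obtain ⟨hv', hu'⟩ := Finset.mem_product.1 (Finset.mem_filter.1 hq').1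
      simp only [Prod.mk.injEq] at h
      exact Prod.ext (hx hv hv' h.1) (hx' hu hu' h.2)
  · intro A B E D
    refine le_trans (Nat.cast_le.2 (le_trans ?_ (Finset.card_image_le (f := x))))
      (Nat.cast_le.2 (card_filter_linear_le ε Y C h0 A B E D))
    refine Finset.card_le_card fun s hs => ?_
    obtain ⟨hs, h1, h2⟩ := Finset.mem_filter.1 hs
    obtain ⟨v, hv, rfl⟩ := Finset.mem_image.1 hs
    refine Finset.mem_image_of_mem _ (Finset.mem_filter.2 ⟨hv, ?_, ?_⟩)
    · rw [hW v hv, div_eq_iff (hS v), add_mul, mul_assoc, div_mul_cancel₀ _ (hS v)] at h1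
      exact h1
    · rw [hZ v hv, div_eq_iff (hS v), add_mul, mul_assoc, div_mul_cancel₀ _ (hS v)] at h2
      exact h2
  · intro A B E D
    refine le_trans (Nat.cast_le.2 (le_trans ?_ (Finset.card_image_le (f := fun v => -x v))))
      (Nat.cast_le.2 (card_filter_linear_le ε Y C h0 A (-B) (-E) D))
    refine Finset.card_le_card fun s hs => ?_
    obtain ⟨hs, h1, h2⟩ := Finset.mem_filter.1 hs
    obtain ⟨v, hv, rfl⟩ := Finset.mem_image.1 hs
    have hxS : x v * S v = R v := div_mul_cancel₀ _ (hS v)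
    refine Finset.mem_image_of_mem (fun v => -x v) (Finset.mem_filter.2 ⟨hv, ?_, ?_⟩)
    · rw [neg_neg, hW v hv, neg_eq_iff_eq_neg, div_eq_iff (hS v)] at h1
      simp only [S, R] at h1 hxS ⊢
      linear_combination h1 + D * hxS
    · rw [neg_neg, hZ v hv, div_eq_iff (hS v)] at h2
      simp only [S, R] at h2 hxS ⊢
      linear_combination h2 - E * hxS

end ScaledDifferences

end

section Energy

variable {α β γ : Type*} [DecidableEq γ]

lemma card_filter_eq_eq_sum (φ : α → γ) (ψ : β → γ) (V : Finset α) (W : Finset β) (I : Finset γ)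
    (hI : ∀ v ∈ V, φ v ∈ I) :
    ((V ×ˢ W).filter fun q => φ q.1 = ψ q.2).card =
      ∑ z ∈ I, (V.filter fun v => φ v = z).card * (W.filter fun w => ψ w = z).card := by
  rw [Finset.card_eq_sum_card_fiberwise (f := fun q => φ q.1) (t := I) fun q hq =>
    hI _ (Finset.mem_product.1 (Finset.mem_filter.1 hq).1).1]
  refine Finset.sum_congr rfl fun z _ => ?_
  rw [← Finset.card_product]
  congr 1
  ext q
  simp only [Finset.mem_filter, Finset.mem_product]
  constructor
  · rintro ⟨⟨⟨h1, h2⟩, h3⟩, h4⟩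
    exact ⟨⟨h1, h4⟩, h2, h3 ▸ h4⟩
  · rintro ⟨⟨h1, h4⟩, h2, h3⟩
    exact ⟨⟨⟨h1, h2⟩, h4.trans h3.symm⟩, h4⟩

lemma sq_card_filter_eq_le (φ : α → γ) (ψ : β → γ) (V : Finset α) (W : Finset β) :
    ((V ×ˢ W).filter fun q => φ q.1 = ψ q.2).card ^ 2 ≤
      ((V ×ˢ V).filter fun q => φ q.1 = φ q.2).card *
        ((W ×ˢ W).filter fun q => ψ q.1 = ψ q.2).card := by
  have hV : ∀ v ∈ V, φ v ∈ V.image φ ∪ W.image ψ := fun v hv =>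
    Finset.mem_union_left _ (Finset.mem_image_of_mem _ hv)
  have hW : ∀ w ∈ W, ψ w ∈ V.image φ ∪ W.image ψ := fun w hw =>
    Finset.mem_union_right _ (Finset.mem_image_of_mem _ hw)
  rw [card_filter_eq_eq_sum φ ψ V W _ hV, card_filter_eq_eq_sum φ φ V V _ hV,
    card_filter_eq_eq_sum ψ ψ W W _ hW]
  simp only [← pow_two]
  exact Finset.sum_mul_sq_le_sq_mul_sq _ _ _

lemma sq_card_le_card_image_mul (φ : α → γ) (V : Finset α) :
    V.card ^ 2 ≤ (V.image φ).card * ((V ×ˢ V).filter fun q => φ q.1 = φ q.2).card := by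
  have hV : ∀ v ∈ V, φ v ∈ V.image φ := fun v hv => Finset.mem_image_of_mem _ hv
  rw [card_filter_eq_eq_sum φ φ V V _ hV, Finset.card_eq_sum_card_fiberwise hV]
  simp only [← pow_two]
  exact sq_sum_le_card_mul_sum_sq

end Energy

section Projection

variable {F : Type*} [Field F] [DecidableEq F]

/-- Cauchy–Schwarz for the collisions of the projections `(a, b) ↦ a y + b`, `y ∈ Y`, restricted
to subsets of `C × C`. -/
lemma sq_sum_card_collisions_le (Y C : Finset F) (G : F → Finset (F × F))
    (hG : ∀ y ∈ Y, G y ⊆ C ×ˢ C) :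
    (∑ y ∈ Y, ((G y ×ˢ G y).filter fun q =>
        q.1.1 * y + q.1.2 = q.2.1 * y + q.2.2).card) ^ 2 ≤
      (((Y ×ˢ C ×ˢ C) ×ˢ (Y ×ˢ C ×ˢ C)).filter fun q =>
        q.1.1 * (q.1.2.1 - q.2.2.2) = q.2.1 * (q.2.2.1 - q.1.2.2)).card *
      addEnergy (C : Set F) := by
  have h1 := sq_card_filter_eq_le (fun w : F × F × F => (w.2.1 - w.2.2) * w.1)
    (fun z : F × F => z.2 - z.1) (Y ×ˢ C ×ˢ C) (C ×ˢ C)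
  refine le_trans (Nat.pow_le_pow_left ?_ 2) (h1.trans (Nat.mul_le_mul ?_ ?_))
  · rw [← Finset.card_sigma]
    refine Finset.card_le_card_of_injOn
      (fun s => ((s.1, s.2.1.1, s.2.2.1), (s.2.1.2, s.2.2.2))) ?_ ?_
    · rintro ⟨y, ⟨a, b⟩, ⟨a', b'⟩⟩ h
      obtain ⟨hy, h⟩ := Finset.mem_sigma.1 h
      obtain ⟨h, he⟩ := Finset.mem_filter.1 h
      obtain ⟨h1, h2⟩ := Finset.mem_product.1 h
      obtain ⟨h3, h4⟩ := Finset.mem_product.1 (hG y hy h1)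
      obtain ⟨h5, h6⟩ := Finset.mem_product.1 (hG y hy h2)
      refine Finset.mem_filter.2 ⟨?_, ?_⟩
      · simp only [Finset.mem_product]
        exact ⟨⟨hy, h3, h5⟩, h4, h6⟩
      · simp only at he ⊢
        linear_combination he
    · rintro ⟨y, ⟨a, b⟩, ⟨a', b'⟩⟩ - ⟨y₁, ⟨a₁, b₁⟩, ⟨a₁', b₁'⟩⟩ - h
      simp only [Prod.mk.injEq] at h
      obtain ⟨⟨rfl, rfl, rfl⟩, rfl, rfl⟩ := h
      rfl
  · refine Finset.card_le_card_of_injOn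
      (fun q => ((q.1.1, q.1.2.1, q.2.2.2), (q.2.1, q.2.2.1, q.1.2.2))) ?_ ?_
    · rintro ⟨⟨y, a, c⟩, ⟨y', a', c'⟩⟩ h
      obtain ⟨h, he⟩ := Finset.mem_filter.1 h
      refine Finset.mem_filter.2 ⟨?_, ?_⟩
      · simp only [Finset.mem_product] at h ⊢
        tauto
      · simp only at he ⊢
        linear_combination he
    · rintro ⟨⟨y, a, c⟩, ⟨y', a', c'⟩⟩ - ⟨⟨y₁, a₁, c₁⟩, ⟨y₁', a₁', c₁'⟩⟩ - h
      simp only [Prod.mk.injEq] at h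
      obtain ⟨⟨rfl, rfl, rfl⟩, rfl, rfl, rfl⟩ := h
      rfl
  · rw [addEnergy, addEnergy2, ← Set.ncard_coe_finset]
    refine Set.ncard_le_ncard_of_injOn (fun q => (q.1.2, q.2.1, q.2.2, q.1.1)) ?_ ?_ ?_
    · rintro ⟨⟨b, b'⟩, ⟨d, d'⟩⟩ h
      obtain ⟨h, he⟩ := Finset.mem_filter.1 h
      simp only [Finset.mem_product] at h
      refine ⟨h.1.2, h.2.1, h.2.2, h.1.1, ?_⟩
      simp only at he ⊢
      linear_combination he
    · rintro ⟨⟨b, b'⟩, ⟨d, d'⟩⟩ - ⟨⟨b₁, b₁'⟩, ⟨d₁, d₁'⟩⟩ - h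
      simp only [Prod.mk.injEq] at h
      obtain ⟨rfl, rfl, rfl, rfl⟩ := h
      rfl
    · refine (C ×ˢ C ×ˢ C ×ˢ C).finite_toSet.subset ?_
      rintro t ⟨h1, h2, h3, h4, -⟩
      simp only [Finset.coe_product, Set.mem_prod]
      exact ⟨h1, h2, h3, h4⟩

end Projection

section Main

/-- The incidence bound in the range `|Y| ≤ c₁ |C|²`, `|C|² |Y| ≤ c₂ p²`. -/
lemma exists_card_scaled_sub_eq_le (c₁ c₂ : ℝ) : ∃ κ : ℝ, 0 < κ ∧
    ∀ (p : ℕ) [Fact p.Prime] (Y C : Finset (ZMod p)), Y.Nonempty → (0 : ZMod p) ∉ Y →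
      (Y.card : ℝ) ≤ c₁ * (C.card : ℝ) ^ 2 → (C.card : ℝ) ^ 2 * Y.card ≤ c₂ * (p : ℝ) ^ 2 →
      ((((Y ×ˢ C ×ˢ C) ×ˢ (Y ×ˢ C ×ˢ C)).filter fun q =>
        q.1.1 * (q.1.2.1 - q.2.2.2) = q.2.1 * (q.2.2.1 - q.1.2.2)).card : ℝ) ≤
      κ * ((C.card : ℝ) ^ 3 * (Y.card * √Y.card)) := by
  obtain ⟨m, hm⟩ := exists_nat_ge (10 ^ 12 + |162 * c₂| + 1)
  have hm12 : 10 ^ 12 ≤ m := by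
    have : (10 : ℝ) ^ 12 ≤ m := by linarith [abs_nonneg (162 * c₂)]
    exact_mod_cast this
  have hmc : 162 * c₂ < m := by linarith [le_abs_self (162 * c₂)]
  have hm0 : (0 : ℝ) ≤ m := Nat.cast_nonneg m
  refine ⟨1800 * m + 2 * (1 + √c₁), by positivity, ?_⟩
  intro p _ Y C hY h0 h1 h2
  have hp : (0 : ℝ) < p := by exact_mod_cast (Fact.out : p.Prime).pos
  refine (card_scaled_sub_eq_le p m hm12 Y C h0 ?_).trans ?_
  · have : (81 : ℝ) * (2 * (Y.card * (C.card * C.card))) < m * p ^ 2 := by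
      have := mul_lt_mul_of_pos_right hmc (pow_pos hp 2)
      nlinarith
    exact_mod_cast this
  · push_cast
    have hy1 : (1 : ℝ) ≤ Y.card := by exact_mod_cast hY.card_pos
    have hc0 : (0 : ℝ) ≤ C.card := Nat.cast_nonneg _
    generalize (Y.card : ℝ) = y at *
    generalize (C.card : ℝ) = c at *
    have hs1 : 1 ≤ √y := Real.one_le_sqrt.2 hy1
    have hss : √y * √y = y := Real.mul_self_sqrt (by linarith)
    have hs2 : √y ≤ √c₁ * c := by
      rw [Real.sqrt_le_left (by positivity), mul_pow]
      refine h1.trans (mul_le_mul_of_nonneg_right ?_ (sq_nonneg c))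
      rcases le_total 0 c₁ with h | h
      · rw [Real.sq_sqrt h]
      · exact h.trans (sq_nonneg _)
    have hs3 : √(2 * (y * (c * c))) ≤ 2 * (√y * c) := by
      rw [Real.sqrt_le_left (by positivity)]
      have : 0 ≤ y * c ^ 2 := by positivity
      calc 2 * (y * (c * c)) ≤ 4 * (y * c ^ 2) := by linarith
        _ = (2 * (√y * c)) ^ 2 := by rw [mul_pow, mul_pow, Real.sq_sqrt (by linarith)]; ring
    have hs4 : c + y ≤ (1 + √c₁) * (c * √y) := by
      have e1 : c * 1 ≤ c * √y := mul_le_mul_of_nonneg_left hs1 hc0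
      have e2 : √y * √y ≤ √c₁ * c * √y := mul_le_mul_of_nonneg_right hs2 (by linarith)
      linarith
    have hyc : 0 ≤ 2 * (y * (c * c)) := by positivity
    calc 450 * m * (2 * (y * (c * c)) * √(2 * (y * (c * c)))) + (c + y) * (2 * (y * (c * c)))
        ≤ 450 * m * (2 * (y * (c * c)) * (2 * (√y * c)))
          + (1 + √c₁) * (c * √y) * (2 * (y * (c * c))) := by gcongr
      _ = (1800 * m + 2 * (1 + √c₁)) * (c ^ 3 * (y * √y)) := by ring

end Main

/-- a robust projection theorem: under the hypotheses of Rudnev's energy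
bound, if $N^2 M \le c_3 |Y|^{1/4}|C|^{5/2}/E^+(C)^{1/2}$, then there is $y \in Y$ such that
every $E' \subseteq C \times C$ with $|E'| \ge |C \times C|/N$ satisfies
$\#\{ay + b : (a,b) \in E'\} > M$. -/
theorem statement17 :
    ∀ c₁ c₂ : ℝ, 0 < c₁ → 0 < c₂ →
      ∃ c₃ : ℝ, 0 < c₃ ∧
        ∀ (p : ℕ) [Fact p.Prime] (Y C : Set (ZMod p)) (N M : ℝ),
          Y.Nonempty → (0 : ZMod p) ∉ Y → C.Nonempty →
          (Y.ncard : ℝ) ≤ c₁ * (C.ncard : ℝ) ^ (2 : ℕ) →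
          (C.ncard : ℝ) ^ (2 : ℕ) * (Y.ncard : ℝ) ≤ c₂ * (p : ℝ) ^ (2 : ℕ) →
          0 < N → 0 < M →
          N ^ (2 : ℕ) * M ≤
            c₃ * (Y.ncard : ℝ) ^ (1/4 : ℝ) * (C.ncard : ℝ) ^ (5/2 : ℝ) /
              (addEnergy C : ℝ) ^ (1/2 : ℝ) →
          ∃ y ∈ Y,
            ∀ E' : Set (ZMod p × ZMod p), E' ⊆ C ×ˢ C →
              ((C ×ˢ C : Set (ZMod p × ZMod p)).ncard : ℝ) / N ≤ (E'.ncard : ℝ) →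
              M < (((fun z : ZMod p × ZMod p => z.1 * y + z.2) '' E').ncard : ℝ) := by
  intro c₁ c₂ _ _
  obtain ⟨κ, hκ, hκT⟩ := exists_card_scaled_sub_eq_le c₁ c₂
  refine ⟨1 / (κ + 1), by positivity, ?_⟩
  intro p _ Y C N M hY h0 hC h1 h2 hN hM hNM
  classical
  lift Y to Finset (ZMod p) using Y.toFinite
  lift C to Finset (ZMod p) using C.toFinite
  simp only [Set.ncard_coe_finset, Finset.mem_coe, Finset.coe_nonempty] at *
  rw [← Finset.coe_product, Set.ncard_coe_finset, Finset.card_product]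
  by_contra! hcon
  have hG : ∀ y, ∃ G : Finset (ZMod p × ZMod p), y ∈ Y → G ⊆ C ×ˢ C ∧
      ((C.card * C.card : ℕ) : ℝ) / N ≤ G.card ∧
      ((G.image fun z : ZMod p × ZMod p => z.1 * y + z.2).card : ℝ) ≤ M := by
    intro y
    by_cases hy : y ∈ Y
    · obtain ⟨E', hE, hE1, hE2⟩ := hcon y hy
      lift E' to Finset (ZMod p × ZMod p) using E'.toFinite
      refine ⟨E', fun _ => ⟨Finset.coe_subset.1 hE, by simpa using hE1, ?_⟩⟩
      rwa [← Finset.coe_image, Set.ncard_coe_finset] at hE2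
    · exact ⟨∅, fun h => absurd h hy⟩
  choose G hG using hG
  have hT := hκT p Y C hY h0 h1 h2
  have hQ := sq_sum_card_collisions_le Y C G fun y hy => (hG y hy).1
  set Q := ∑ y ∈ Y, ((G y ×ˢ G y).filter fun q => q.1.1 * y + q.1.2 = q.2.1 * y + q.2.2).card
    with hQdef
  have hQT : (Q : ℝ) ^ 2 ≤ κ * ((C.card : ℝ) ^ 3 * (Y.card * √Y.card)) * addEnergy (C : Set (ZMod p)) :=
    le_trans (by exact_mod_cast hQ) (mul_le_mul_of_nonneg_right hT (Nat.cast_nonneg _))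
  have hlow : (Y.card : ℝ) * (C.card * C.card / N) ^ 2 ≤ M * Q := by
    rw [hQdef, Nat.cast_sum, Finset.mul_sum, ← nsmul_eq_mul]
    refine Finset.card_nsmul_le_sum _ _ _ fun y hy => ?_
    obtain ⟨-, hc, hi⟩ := hG y hy
    push_cast at hc
    calc (C.card * C.card / N : ℝ) ^ 2 ≤ ((G y).card : ℝ) ^ 2 := by gcongr
      _ ≤ ((G y).image fun z : ZMod p × ZMod p => z.1 * y + z.2).card *
          (((G y ×ˢ G y).filter fun q => q.1.1 * y + q.1.2 = q.2.1 * y + q.2.2).card : ℝ) := by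
        exact_mod_cast sq_card_le_card_image_mul (fun z : ZMod p × ZMod p => z.1 * y + z.2) (G y)
      _ ≤ _ := by gcongr
  have hy0 : (0 : ℝ) < Y.card := by exact_mod_cast hY.card_pos
  have hc0 : (0 : ℝ) < C.card := by exact_mod_cast hC.card_pos
  have he0 : (0 : ℝ) ≤ addEnergy (C : Set (ZMod p)) := Nat.cast_nonneg _
  have hq0 : (0 : ℝ) ≤ Q := Nat.cast_nonneg _
  generalize (Y.card : ℝ) = y at *
  generalize (C.card : ℝ) = c at *
  generalize (addEnergy (C : Set (ZMod p)) : ℝ) = e at *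
  generalize (Q : ℝ) = q at *
  have hlow' : y * c ^ 4 ≤ N ^ 2 * M * q := by
    have := mul_le_mul_of_nonneg_left hlow (sq_nonneg N)
    calc y * c ^ 4 = N ^ 2 * (y * (c * c / N) ^ 2) := by field_simp
      _ ≤ N ^ 2 * M * q := by linarith
  have hsq : (N ^ 2 * M) ^ 2 ≤ (1 / (κ + 1)) ^ 2 * √y * c ^ 5 / e := by
    calc (N ^ 2 * M) ^ 2
        ≤ (1 / (κ + 1) * y ^ (1 / 4 : ℝ) * c ^ (5 / 2 : ℝ) / e ^ (1 / 2 : ℝ)) ^ 2 := by gcongr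
      _ = (1 / (κ + 1)) ^ 2 * √y * c ^ 5 / e := by
        rw [div_pow, mul_pow, mul_pow, ← Real.rpow_mul_natCast hy0.le,
          ← Real.rpow_mul_natCast hc0.le, ← Real.rpow_mul_natCast he0, Real.sqrt_eq_rpow,
          ← Real.rpow_natCast c 5]
        norm_num
  have he : 0 < e := by
    refine lt_of_le_of_ne he0 fun h => ?_
    rw [← h, div_zero] at hsq
    have : 0 < (N ^ 2 * M) ^ 2 := by positivity
    linarith
  have hss : √y * √y = y := Real.mul_self_sqrt hy0.le
  have hfin : (y * c ^ 4) ^ 2 ≤ κ / (κ + 1) ^ 2 * (y * c ^ 4) ^ 2 := by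
    calc (y * c ^ 4) ^ 2 ≤ (N ^ 2 * M * q) ^ 2 := by gcongr
      _ = (N ^ 2 * M) ^ 2 * q ^ 2 := by ring
      _ ≤ ((1 / (κ + 1)) ^ 2 * √y * c ^ 5 / e) * (κ * (c ^ 3 * (y * √y)) * e) := by gcongr
      _ = κ / (κ + 1) ^ 2 * (√y * √y * y * c ^ 8) := by field_simp
      _ = κ / (κ + 1) ^ 2 * (y * c ^ 4) ^ 2 := by rw [hss]; ring
  have hlt : κ / (κ + 1) ^ 2 < 1 := by
    rw [div_lt_one (by positivity)]
    nlinarith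
  have hpos : 0 < (y * c ^ 4) ^ 2 := by positivity
  nlinarith
end

section
/- Let p be a prime, let N ≥ 1 be an integer, and let E ⊆ F_p^2 with |E| ≥ 2N. Then the number of one-dimensional linear subspaces ℓ of F_p^2 such that |π_ℓ(E)| ≤ N is at most 2N. -/
open scoped BigOperators

/-- The orthogonal complement of a subspace of `Fin d → F` with respect to the
dot product `x · y = ∑ i, x i * y i`. -/
noncomputable def perp {F : Type*} [Field F] {d : ℕ} (V : Submodule F (Fin d → F)) :
    Submodule F (Fin d → F) where
  carrier := {y | ∀ x ∈ V, ∑ i, x i * y i = 0}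
  zero_mem' := by
    intro x hx
    simp
  add_mem' := by
    intro a b ha hb x hx
    have h : ∑ i, x i * (a + b) i = (∑ i, x i * a i) + (∑ i, x i * b i) := by
      simp [mul_add, Finset.sum_add_distrib]
    simp only [Set.mem_setOf_eq] at ha hb ⊢
    rw [h, ha x hx, hb x hx, add_zero]
  smul_mem' := by
    intro c y hy x hx
    have h : ∑ i, x i * (c • y) i = c * ∑ i, x i * y i := by
      rw [Finset.mul_sum]
      refine Finset.sum_congr rfl fun i _ => ?_
      simp [mul_left_comm]
    simp only [Set.mem_setOf_eq] at hy ⊢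
    rw [h, hy x hx, mul_zero]

/-- `projCount V E` is the size `|π_V(E)|` of the orthogonal projection of `E` onto `V`,
i.e. the number of cosets of `V^⊥` meeting `E`, i.e. the cardinality of the image of `E`
under the quotient map `F^d → F^d / V^⊥`. -/
noncomputable def projCount {F : Type*} [Field F] {d : ℕ}
    (V : Submodule F (Fin d → F)) (E : Set (Fin d → F)) : ℕ :=
  ((perp V).mkQ '' E).ncard

/-- `Tset F k d s E` is `T_s^{k,d}(E)`, the set of `k`-dimensional subspaces `V`
with `|π_V(E)| < q^s`. -/
noncomputable def Tset (F : Type*) [Field F] [Fintype F] (k d : ℕ) (s : ℝ)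
    (E : Set (Fin d → F)) : Set (Submodule F (Fin d → F)) :=
  {V | Module.finrank F ↥V = k ∧ (projCount V E : ℝ) < (Fintype.card F : ℝ) ^ s}

/-- Cauchy–Schwarz for the fibres of `f` on `s`, with the diagonal pairs separated out. -/
theorem Finset.card_sq_le_card_image_mul_card_offDiag_filter {α β : Type*} [DecidableEq α]
    [DecidableEq β] (s : Finset α) (f : α → β) :
    s.card ^ 2 ≤
      (s.image f).card * (s.card + (s.offDiag.filter fun x => f x.1 = f x.2).card) := by
  have hfib : s.card = ∑ b ∈ s.image f, (s.filter fun a => f a = b).card :=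
    Finset.card_eq_sum_card_image f s
  have hpairs : ((s ×ˢ s).filter fun x => f x.1 = f x.2).card =
      ∑ b ∈ s.image f, (s.filter fun a => f a = b).card ^ 2 := by
    rw [Finset.card_eq_sum_card_fiberwise (f := fun x => f x.1) (t := s.image f)]
    · refine Finset.sum_congr rfl fun b _ => ?_
      rw [sq, ← Finset.card_product]
      congr 1
      ext x
      simp only [Finset.mem_filter, Finset.mem_product]
      grind
    · intro x hx
      simp only [Finset.coe_filter, Finset.mem_product, Set.mem_ofPred_eq] at hx
      exact Finset.mem_coe.2 (Finset.mem_image_of_mem f hx.1.1)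
  have hsplit : ((s ×ˢ s).filter fun x => f x.1 = f x.2).card =
      s.card + (s.offDiag.filter fun x => f x.1 = f x.2).card := by
    rw [← Finset.diag_union_offDiag, Finset.filter_union, Finset.card_union_of_disjoint
      (Finset.disjoint_filter_filter (Finset.disjoint_diag_offDiag s)), Finset.filter_true_of_mem,
      Finset.diag_card]
    intro x hx
    rw [(Finset.mem_diag.1 hx).2]
  rw [← hsplit, hpairs]
  calc s.card ^ 2 = (∑ b ∈ s.image f, (s.filter fun a => f a = b).card) ^ 2 := by rw [← hfib]
    _ ≤ _ := sq_sum_le_card_mul_sum_sq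

/-- A nonzero vector of the plane is orthogonal to at most one line. -/
theorem eq_of_mem_perp_of_finrank_eq_one {F : Type*} [Field F] {V W : Submodule F (Fin 2 → F)}
    (hV : Module.finrank F V = 1) (hW : Module.finrank F W = 1) {v : Fin 2 → F} (hv : v ≠ 0)
    (hvV : v ∈ perp V) (hvW : v ∈ perp W) : V = W := by
  let φ : Module.Dual F (Fin 2 → F) := dotProductEquiv F (Fin 2) v
  have hφ : φ ≠ 0 := (dotProductEquiv F (Fin 2)).map_ne_zero_iff.2 hv
  have hker : Module.finrank F (LinearMap.ker φ) = 1 := by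
    have h := Module.Dual.finrank_ker_add_one_of_ne_zero hφ
    rw [Module.finrank_fin_fun] at h
    omega
  have key : ∀ U : Submodule F (Fin 2 → F), Module.finrank F U = 1 → v ∈ perp U →
      U = LinearMap.ker φ := fun U hU hvU =>
    Submodule.eq_of_le_of_finrank_eq
      (fun x hx => by
        rw [LinearMap.mem_ker]
        exact (dotProduct_comm v x).trans (hvU x hx))
      (hU.trans hker.symm)
  rw [key V hV hvV, key W hW hvW]

/-- if $|E| \ge 2N$, then the number of one-dimensional subspaces
$\ell$ of $\mathbb{F}_p^2$ with $|\pi_\ell(E)| \le N$ is at most $2N$. -/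
theorem statement18 (p : ℕ) [Fact p.Prime] (N : ℕ) (hN : 1 ≤ N)
    (E : Set (Fin 2 → ZMod p)) (hE : 2 * N ≤ E.ncard) :
    ({ℓ : Submodule (ZMod p) (Fin 2 → ZMod p) |
        Module.finrank (ZMod p) ↥ℓ = 1 ∧ projCount ℓ E ≤ N}).ncard ≤ 2 * N := by
  classical
  set L := {ℓ : Submodule (ZMod p) (Fin 2 → ZMod p) |
    Module.finrank (ZMod p) ↥ℓ = 1 ∧ projCount ℓ E ≤ N}
  let D : Finset (Submodule (ZMod p) (Fin 2 → ZMod p)) := L.toFinite.toFinset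
  let s : Finset (Fin 2 → ZMod p) := E.toFinite.toFinset
  have hs : (s : Set (Fin 2 → ZMod p)) = E := E.toFinite.coe_toFinset
  have hD : ∀ ℓ ∈ D, Module.finrank (ZMod p) ℓ = 1 ∧ projCount ℓ E ≤ N := fun ℓ hℓ =>
    L.toFinite.mem_toFinset.1 hℓ
  rw [Set.ncard_eq_toFinset_card E] at hE
  rw [Set.ncard_eq_toFinset_card L]
  change 2 * N ≤ s.card at hE
  change D.card ≤ 2 * N
  let P (ℓ : Submodule (ZMod p) (Fin 2 → ZMod p)) :=
    s.offDiag.filter fun x => (perp ℓ).mkQ x.1 = (perp ℓ).mkQ x.2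
  have hlower : ∀ ℓ ∈ D, s.card ^ 2 ≤ N * (s.card + (P ℓ).card) := by
    intro ℓ hℓ
    refine (s.card_sq_le_card_image_mul_card_offDiag_filter (perp ℓ).mkQ).trans
      (Nat.mul_le_mul_right _ ?_)
    rw [← Set.ncard_coe_finset, Finset.coe_image, hs]
    exact (hD ℓ hℓ).2
  have hdisj : (D : Set (Submodule (ZMod p) (Fin 2 → ZMod p))).PairwiseDisjoint P := by
    intro ℓ hℓ m hm hne
    refine Finset.disjoint_left.2 fun x hxℓ hxm => hne ?_
    obtain ⟨hx, h₁⟩ := Finset.mem_filter.1 hxℓ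
    have h₂ := (Finset.mem_filter.1 hxm).2
    exact eq_of_mem_perp_of_finrank_eq_one (hD ℓ hℓ).1 (hD m hm).1
      (sub_ne_zero.2 (Finset.mem_offDiag.1 hx).2.2)
      ((Submodule.Quotient.eq _).1 h₁) ((Submodule.Quotient.eq _).1 h₂)
  have hupper : ∑ ℓ ∈ D, (P ℓ).card ≤ s.card * s.card - s.card := by
    rw [← Finset.card_biUnion hdisj, ← Finset.offDiag_card]
    exact Finset.card_le_card (Finset.biUnion_subset.2 fun ℓ _ => Finset.filter_subset _ _)
  have hcount : D.card * s.card ^ 2 ≤ N * (D.card * s.card + s.card ^ 2) := by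
    calc D.card * s.card ^ 2 ≤ ∑ ℓ ∈ D, N * (s.card + (P ℓ).card) := by
          simpa using Finset.card_nsmul_le_sum D _ _ hlower
      _ = N * (D.card * s.card + ∑ ℓ ∈ D, (P ℓ).card) := by
          rw [← Finset.mul_sum, Finset.sum_add_distrib, Finset.sum_const, smul_eq_mul]
      _ ≤ N * (D.card * s.card + s.card ^ 2) := by
          gcongr
          exact hupper.trans ((Nat.sub_le _ _).trans (sq _).ge)
  have hpos : 0 < s.card := by omega
  have hcancel : D.card * s.card ≤ N * (D.card + s.card) :=
    Nat.le_of_mul_le_mul_right (by linarith) hpos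
  refine Nat.le_of_mul_le_mul_right (?_ : D.card * s.card ≤ 2 * N * s.card) hpos
  nlinarith [Nat.mul_le_mul_left D.card hE]
end
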